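/- An odd unimodular lattice L in dimension 36 with minimum norm 3 has kissing number at most 960, and its shadow has minimum norm at most 5. -/

import Mathlib

/-- The dual of a set of vectors in `ℝⁿ`. -/
def dualLattice {n : ℕ} (L : Set (Fin n → ℝ)) : Set (Fin n → ℝ) :=
  {v | ∀ w ∈ L, ∃ m : ℤ, ∑ i, v i * w i = (m : ℝ)}

/-- The even sublattice (even-norm part) of a set of vectors. -/
def evenPart {n : ℕ} (L : Set (Fin n → ℝ)) : Set (Fin n → ℝ) :=
  {x ∈ L | ∃ m : ℤ, ∑ i, x i * x i = ((2 * m : ℤ) : ℝ)}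

/-- The shadow `S(L) = (L₀)* \ L` of an odd unimodular lattice. -/
def shadow {n : ℕ} (L : Set (Fin n → ℝ)) : Set (Fin n → ℝ) :=
  dualLattice (evenPart L) \ L

open UpperHalfPlane ModularForm SlashInvariantForm Asymptotics Filter MatrixGroups in
/-- A periodic holomorphic function on the upper half plane that is bounded at `i∞` and transforms
under `z ↦ -1/z` with weight `k` is a modular form of level one. -/
lemma exists_modularForm_levelOne (k : ℕ) (f : ℂ → ℂ)
    (hd : DifferentiableOn ℂ f {z : ℂ | 0 < z.im})
    (hT : ∀ z : ℂ, 0 < z.im → f (z + 1) = f z)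
    (hS : ∀ z : ℂ, 0 < z.im → f (-1 / z) = z ^ k * f z)
    (hb : (fun z : ℍ ↦ f z) =O[atImInfty] (1 : ℍ → ℝ)) :
    ∃ F : ModularForm 𝒮ℒ k, ∀ z : ℍ, F z = f z := by
  have h1 : (fun z : ℍ ↦ f z) ∣[(k : ℤ)] ModularGroup.S = fun z : ℍ ↦ f z := by
    ext z
    have hz : (z : ℂ) ≠ 0 := z.ne_zero
    suffices f (-(↑z)⁻¹) * ((z : ℂ) ^ k)⁻¹ = f z by
      rw [SL_slash_apply, UpperHalfPlane.modular_S_smul]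
      simpa [ModularGroup.denom_S]
    have := hS z z.im_pos
    rw [neg_div, one_div] at this
    rw [this]
    field_simp
  have h2 : (fun z : ℍ ↦ f z) ∣[(k : ℤ)] ModularGroup.T = fun z : ℍ ↦ f z := by
    ext z
    have hden : denom ModularGroup.T z = 1 := by
      rw [ModularGroup.denom_apply]; simp [ModularGroup.T]
    rw [SL_slash_apply, hden, UpperHalfPlane.modular_T_smul]
    simp only [coe_vadd]
    have := hT z z.im_pos
    rw [add_comm] at this
    simpa using this
  have h3 := slash_action_generators_SL2Z h1 h2
  refine ⟨{ toFun := fun z : ℍ ↦ f z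
            slash_action_eq' := ?_
            holo' := ?_
            bdd_at_cusps' := ?_ }, fun z ↦ rfl⟩
  · rintro A ⟨A, rfl⟩
    exact h3 A
  · rw [UpperHalfPlane.mdifferentiable_iff]
    refine hd.congr fun z hz ↦ ?_
    simp [ofComplex_apply_of_im_pos hz]
  · intro c hc
    rw [Subgroup.IsArithmetic.isCusp_iff_isCusp_SL2Z] at hc
    rw [OnePoint.isBoundedAt_iff_forall_SL2Z hc]
    intro γ _
    rw [h3]
    exact hb

open UpperHalfPlane ModularForm SlashInvariantForm Asymptotics Filter MatrixGroups in
/-- A level one modular form of weight `12 m + 2` vanishing at `i∞` to order larger than `m - 1`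
is zero. -/
lemma modularForm_levelOne_eq_zero (m : ℕ) (k : ℤ) (hk : k = 12 * m + 2) (F : ModularForm 𝒮ℒ k)
    (h : ∀ j : ℕ, j < m → F =o[atImInfty] fun z : ℍ ↦ Real.exp (-2 * Real.pi * z.im) ^ j) :
    F = 0 := by
  induction m generalizing k with
  | zero =>
    obtain rfl : k = 2 := by simpa using hk
    exact rank_zero_iff_forall_zero.mp levelOne_weight_two_rank_zero F
  | succ m ih =>
    have h0 : IsZeroAtImInfty F := by
      have := h 0 (by omega)
      simp only [pow_zero] at this
      exact (isLittleO_one_iff ℝ).mp this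
    have hc : (qExpansion 1 F).coeff 0 = 0 := by
      rw [qExpansion_coeff_zero one_pos
        (ModularFormClass.analyticAt_cuspFunction_zero F one_pos one_mem_strictPeriods_SL)
        (SlashInvariantFormClass.periodic_comp_ofComplex F one_mem_strictPeriods_SL)]
      exact h0.valueAtInfty_eq_zero
    set G := CuspForm.discriminantEquiv (toCuspForm F hc)
    have hG : ∀ z, ModularForm.discriminant z * G z = F z := fun z ↦ by
      rw [discriminant_mul_discriminantEquiv_apply, toCuspForm_apply]
    have hG0 : G = 0 := by
      refine ih (k - 12) (by rw [hk]; push_cast; ring) G fun j hj ↦ ?_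
      have h1 := h (j + 1) (by omega)
      have h2 := exp_isBigO_discriminant
      have h3 : (fun z ↦ ModularForm.discriminant z * G z) =o[atImInfty]
          fun z : ℍ ↦ Real.exp (-2 * Real.pi * z.im) ^ (j + 1) := by
        simpa only [hG] using h1
      have h4 : (fun z : ℍ ↦ (Real.exp (-2 * Real.pi * z.im) : ℝ) * ‖G z‖) =o[atImInfty]
          fun z : ℍ ↦ Real.exp (-2 * Real.pi * z.im) ^ (j + 1) :=
        (h2.mul (isBigO_refl (fun z : ℍ ↦ ‖G z‖) _).of_norm_right).trans_isLittleO h3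
      have h5 := (isBigO_refl (fun z : ℍ ↦ (Real.exp (-2 * Real.pi * z.im))⁻¹) atImInfty).mul_isLittleO
        h4
      refine (h5.congr (fun z ↦ ?_) (fun z ↦ ?_)).of_norm_left
      · field_simp
      · rw [pow_succ]; field_simp
    ext z
    rw [← hG z, hG0]
    simp

/-- The series `∑ cᵢ q ^ νᵢ` in the local parameter `q = exp (π i z)`. -/
noncomputable def qSeries {ι : Type*} (c : ι → ℂ) (ν : ι → ℕ) (z : ℂ) : ℂ :=
  ∑' i, c i * Complex.exp (Real.pi * Complex.I * z) ^ ν i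

lemma norm_exp_pi_I_mul (z : ℂ) :
    ‖Complex.exp (Real.pi * Complex.I * z)‖ = Real.exp (-Real.pi * z.im) := by
  rw [Complex.norm_exp]
  congr 1
  simp

lemma norm_exp_pi_I_mul_lt_one {z : ℂ} (hz : 0 < z.im) :
    ‖Complex.exp (Real.pi * Complex.I * z)‖ < 1 := by
  rw [norm_exp_pi_I_mul, Real.exp_lt_one_iff]
  have := Real.pi_pos
  nlinarith

lemma summable_qSeries {ι : Type*} {c : ι → ℂ} {ν : ι → ℕ} (hc : ∀ i, ‖c i‖ ≤ 1)
    (hs : ∀ r : ℝ, 0 ≤ r → r < 1 → Summable fun i ↦ r ^ ν i) {z : ℂ} (hz : 0 < z.im) :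
    Summable fun i ↦ c i * Complex.exp (Real.pi * Complex.I * z) ^ ν i := by
  refine Summable.of_norm_bounded (hs _ (norm_nonneg _) (norm_exp_pi_I_mul_lt_one hz)) fun i ↦ ?_
  rw [norm_mul, norm_pow]
  exact mul_le_of_le_one_left (by positivity) (hc i)

lemma differentiableOn_qSeries {ι : Type*} {c : ι → ℂ} {ν : ι → ℕ} (hc : ∀ i, ‖c i‖ ≤ 1)
    (hs : ∀ r : ℝ, 0 ≤ r → r < 1 → Summable fun i ↦ r ^ ν i) :
    DifferentiableOn ℂ (qSeries c ν) {z : ℂ | 0 < z.im} := by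
  intro z hz
  have hz' : 0 < z.im := hz
  have ho : IsOpen {w : ℂ | z.im / 2 < w.im} := isOpen_lt continuous_const Complex.continuous_im
  have hmem : z ∈ {w : ℂ | z.im / 2 < w.im} := by simpa using half_lt_self hz'
  set r := Real.exp (-Real.pi * (z.im / 2)) with hr
  have hr1 : r < 1 := by
    rw [hr, Real.exp_lt_one_iff]
    have := Real.pi_pos
    nlinarith
  have := Complex.differentiableOn_tsum_of_summable_norm (u := fun i ↦ r ^ ν i)
    (F := fun i w ↦ c i * Complex.exp (Real.pi * Complex.I * w) ^ ν i) (U := {w : ℂ | z.im / 2 < w.im})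
    (hs r (Real.exp_pos _).le hr1) (fun i ↦ by fun_prop) ho fun i w hw ↦ by
      rw [norm_mul, norm_pow, norm_exp_pi_I_mul]
      refine (mul_le_of_le_one_left (by positivity) (hc i)).trans ?_
      refine pow_le_pow_left₀ (Real.exp_pos _).le ?_ _
      rw [hr, Real.exp_le_exp]
      have hw' : z.im / 2 < w.im := hw
      have := Real.pi_pos
      nlinarith
  exact (this.differentiableAt (ho.mem_nhds hmem)).differentiableWithinAt

lemma finite_exponent_lt {ι : Type*} {ν : ι → ℕ}
    (hs : ∀ r : ℝ, 0 ≤ r → r < 1 → Summable fun i ↦ r ^ ν i) (n : ℕ) : {i | ν i < n}.Finite := by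
  have h := (hs (1 / 2) (by norm_num) (by norm_num)).tendsto_cofinite_zero
  have h2 := h.eventually_lt_const (u := (1 / 2 : ℝ) ^ n) (by positivity)
  refine (Filter.eventually_cofinite.mp h2).subset fun i hi ↦ ?_
  have hi' : ν i < n := hi
  simp only [Set.mem_ofPred_eq, not_lt]
  exact pow_le_pow_of_le_one (by norm_num) (by norm_num) hi'.le

open UpperHalfPlane Asymptotics in
/-- The truncated expansion of a `q`-series at `i∞`. -/
lemma exists_qSeries_eq_sum_add {ι : Type*} {c : ι → ℂ} {ν : ι → ℕ} (hc : ∀ i, ‖c i‖ ≤ 1)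
    (hs : ∀ r : ℝ, 0 ≤ r → r < 1 → Summable fun i ↦ r ^ ν i) (n : ℕ) (T : Finset ι)
    (hT : ∀ i, i ∈ T ↔ ν i < n) :
    ∃ r : ℍ → ℂ, r =O[atImInfty] (1 : ℍ → ℝ) ∧ ∀ z : ℍ, qSeries c ν z =
      ∑ i ∈ T, c i * Complex.exp (Real.pi * Complex.I * z) ^ ν i +
        Complex.exp (Real.pi * Complex.I * z) ^ n * r z := by
  refine ⟨fun z ↦ ∑' i : {i // i ∉ T}, c i * Complex.exp (Real.pi * Complex.I * z) ^ (ν i - n),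
    ?_, fun z ↦ ?_⟩
  · have hsub : Summable fun i : {i // i ∉ T} ↦ (1 / 2 : ℝ) ^ (ν i - n) := by
      have h1 : Summable fun i : {i // i ∉ T} ↦ (2 : ℝ) ^ n * (1 / 2) ^ ν i :=
        ((hs (1 / 2) (by norm_num) (by norm_num)).comp_injective
          Subtype.val_injective).mul_left (2 ^ n)
      refine h1.congr fun i ↦ ?_
      have hi : n ≤ ν i := not_lt.mp fun h ↦ i.2 ((hT i).mpr h)
      obtain ⟨k, hk⟩ := Nat.exists_eq_add_of_le hi
      rw [hk, pow_add, Nat.add_sub_cancel_left]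
      simp
    refine IsBigO.of_bound (∑' i : {i // i ∉ T}, (1 / 2 : ℝ) ^ (ν i - n)) ?_
    have : ∀ᶠ z : ℍ in atImInfty, ‖Complex.exp (Real.pi * Complex.I * z)‖ ≤ 1 / 2 := by
      rw [Filter.Eventually, atImInfty_mem]
      refine ⟨1, fun z hz ↦ ?_⟩
      simp only [Set.mem_ofPred_eq]
      rw [norm_exp_pi_I_mul, neg_mul, Real.exp_neg, ← one_div]
      refine one_div_le_one_div_of_le two_pos ?_
      have := Real.add_one_le_exp (Real.pi * (z : ℂ).im)
      have h3 := Real.pi_gt_three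
      have h4 : 1 ≤ (z : ℂ).im := hz
      nlinarith
    filter_upwards [this] with z hz
    simp only [Pi.one_apply, norm_one, mul_one]
    refine tsum_of_norm_bounded hsub.hasSum fun i ↦ ?_
    rw [norm_mul, norm_pow]
    exact (mul_le_of_le_one_left (by positivity) (hc i)).trans (pow_le_pow_left₀ (norm_nonneg _) hz _)
  · have h := summable_qSeries hc hs z.im_pos
    rw [qSeries, ← h.sum_add_tsum_subtype_compl T, ← tsum_mul_left]
    congr 1
    refine tsum_congr fun i ↦ ?_
    have hi : n ≤ ν i := not_lt.mp fun h ↦ i.2 ((hT i).mpr h)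
    obtain ⟨k, hk⟩ := Nat.exists_eq_add_of_le hi
    rw [hk, pow_add, Nat.add_sub_cancel_left]
    ring

open MeasureTheory in
lemma integral_eq_tsum_integral_unit_cube {d : ℕ} {g : (Fin d → ℝ) → ℂ} (hg : Integrable g) :
    ∫ x, g x = ∑' n : Fin d → ℤ, ∫ x in {x : Fin d → ℝ | ∀ i, x i ∈ Set.Ioc (0 : ℝ) (0 + 1)},
      g (x + fun i ↦ (n i : ℝ)) := by
  have hset : ∀ a : Fin d → ℝ, {x : Fin d → ℝ | ∀ i, x i ∈ Set.Ioc (a i) (a i + 1)} =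
      Set.univ.pi fun i ↦ Set.Ioc (a i) (a i + 1) := fun a ↦ by ext; simp
  have hU : (⋃ n : Fin d → ℤ, {x : Fin d → ℝ | ∀ i, x i ∈ Set.Ioc (n i : ℝ) (n i + 1)}) =
      Set.univ := by
    ext x
    simp only [Set.mem_iUnion, Set.mem_univ, iff_true]
    refine ⟨fun i ↦ ⌈x i⌉ - 1, fun i ↦ ?_⟩
    push_cast
    exact ⟨by linarith [Int.ceil_lt_add_one (x i)], by linarith [Int.le_ceil (x i)]⟩
  rw [← setIntegral_univ, ← hU, integral_iUnion]
  · refine tsum_congr fun n ↦ ?_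
    rw [← (measurePreserving_add_right volume (fun i ↦ (n i : ℝ))).setIntegral_preimage_emb
      (measurableEmbedding_addRight _)]
    congr 2
    ext x
    simp only [Set.mem_preimage, Set.mem_ofPred_eq, Pi.add_apply, Set.mem_Ioc]
    refine forall_congr' fun i ↦ ?_
    constructor <;> rintro ⟨h1, h2⟩ <;> constructor <;> linarith
  · intro n
    rw [hset fun i ↦ (n i : ℝ)]
    exact MeasurableSet.univ_pi fun i ↦ measurableSet_Ioc
  · intro n m hnm
    rw [Function.onFun, Set.disjoint_left]
    intro x hx hx'
    refine hnm (funext fun i ↦ ?_)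
    have h1 := hx i
    have h2 := hx' i
    have h3 : (n i : ℝ) < m i + 1 := h1.1.trans_le h2.2
    have h4 : (m i : ℝ) < n i + 1 := h2.1.trans_le h1.2
    norm_cast at h3 h4
    omega
  · exact hg.integrableOn

open MeasureTheory in
/-- Poisson summation for the lattice `ℤᵈ`. -/
theorem tsum_add_int_eq_tsum_fourier {d : ℕ} {f : (Fin d → ℝ) → ℂ} (hf : Continuous f)
    (hint : Integrable f)
    (hu : ∀ R : ℝ, ∃ u : (Fin d → ℤ) → ℝ, Summable u ∧
      ∀ n y, ‖y‖ ≤ R → ‖f (y + fun i ↦ (n i : ℝ))‖ ≤ u n)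
    (hF : Summable fun k : Fin d → ℤ ↦
      ∫ x : Fin d → ℝ, Complex.exp (-(2 * Real.pi * Complex.I * ∑ i, k i * x i)) * f x)
    (y : Fin d → ℝ) :
    ∑' n : Fin d → ℤ, f (y + fun i ↦ (n i : ℝ)) =
      ∑' k : Fin d → ℤ,
        (∫ x : Fin d → ℝ, Complex.exp (-(2 * Real.pi * Complex.I * ∑ i, k i * x i)) * f x) *
          Complex.exp (2 * Real.pi * Complex.I * ∑ i, k i * y i) := by
  set Φ : (Fin d → ℝ) → ℂ := fun y ↦ ∑' n : Fin d → ℤ, f (y + fun i ↦ (n i : ℝ)) with hΦ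
  have hcont : Continuous Φ := by
    rw [continuous_iff_continuousAt]
    intro y₀
    obtain ⟨u, hu1, hu2⟩ := hu (‖y₀‖ + 1)
    have h : ContinuousOn Φ (Metric.ball 0 (‖y₀‖ + 1)) :=
      continuousOn_tsum (fun n ↦ by fun_prop) hu1 fun n y hy ↦
        hu2 n y (by simpa using (Metric.mem_ball.mp hy).le)
    exact h.continuousAt (Metric.isOpen_ball.mem_nhds (by simp))
  have hper : ∀ (y : Fin d → ℝ) (m : Fin d → ℤ), Φ (y + fun i ↦ (m i : ℝ)) = Φ y := by
    intro y m
    simp only [hΦ]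
    rw [← (Equiv.addLeft m).tsum_eq fun n : Fin d → ℤ ↦ f (y + fun i ↦ (n i : ℝ))]
    refine tsum_congr fun n ↦ ?_
    congr 1
    ext i
    simp [add_assoc]
  have hq : IsOpenQuotientMap (fun (x : Fin d → ℝ) (i : Fin d) ↦ (x i : UnitAddCircle)) :=
    IsOpenQuotientMap.piMap (f := fun _ : Fin d ↦ ((↑) : ℝ → UnitAddCircle))
      fun _ ↦ QuotientAddGroup.isOpenQuotientMap_mk
  have hcompat : ∀ a b : Fin d → ℝ, (fun i ↦ (a i : UnitAddCircle)) = (fun i ↦ (b i : UnitAddCircle)) →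
      Φ a = Φ b := by
    intro a b hab
    have h1 : ∀ i, ∃ m : ℤ, b i = a i + m := fun i ↦ by
      have := congrFun hab i
      rw [QuotientAddGroup.eq, AddSubgroup.mem_zmultiples_iff] at this
      obtain ⟨m, hm⟩ := this
      exact ⟨m, by simp at hm; linarith⟩
    choose m hm using h1
    rw [← hper a m]
    congr 1
    ext i
    simp [hm]
  let π : C(Fin d → ℝ, UnitAddTorus (Fin d)) := ⟨_, hq.continuous⟩
  have hπ : Topology.IsQuotientMap π := hq.isQuotientMap
  obtain ⟨G, hGapp⟩ : ∃ G : C(UnitAddTorus (Fin d), ℂ),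
      ∀ x : Fin d → ℝ, G (fun i ↦ (x i : UnitAddCircle)) = Φ x :=
    ⟨hπ.lift ⟨Φ, hcont⟩ fun a b h ↦ hcompat a b h, fun x ↦
      DFunLike.congr_fun (hπ.lift_comp ⟨Φ, hcont⟩ fun a b h ↦ hcompat a b h) x⟩
  have hexp : ∀ (k : Fin d → ℤ) (x : Fin d → ℝ),
      UnitAddTorus.mFourier k (fun i ↦ (x i : UnitAddCircle)) =
        Complex.exp (2 * Real.pi * Complex.I * ∑ i, k i * x i) := by
    intro k x
    simp only [UnitAddTorus.mFourier, ContinuousMap.coe_mk, fourier_coe_apply]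
    rw [← Complex.exp_sum, Complex.ofReal_sum, Finset.mul_sum]
    congr 1
    refine Finset.sum_congr rfl fun i _ ↦ ?_
    simp
    ring
  have hcoef : ∀ k : Fin d → ℤ, UnitAddTorus.mFourierCoeff G k =
      ∫ x : Fin d → ℝ, Complex.exp (-(2 * Real.pi * Complex.I * ∑ i, k i * x i)) * f x := by
    intro k
    set g : (Fin d → ℝ) → ℂ := fun x ↦
      Complex.exp (-(2 * Real.pi * Complex.I * ∑ i, k i * x i)) * f x with hg
    have hnorm : ∀ x : Fin d → ℝ,
        ‖Complex.exp (-(2 * Real.pi * Complex.I * ∑ i, k i * x i))‖ = 1 := fun x ↦ by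
      have : -(2 * Real.pi * Complex.I * ((∑ i, k i * x i : ℝ) : ℂ)) =
          ((-(2 * Real.pi * ∑ i, (k i : ℝ) * (x i : ℝ)) : ℝ) : ℂ) * Complex.I := by
        push_cast; ring
      rw [this, Complex.norm_exp_ofReal_mul_I]
    have hgc : Continuous g := by fun_prop
    have hgi : Integrable g := by
      refine hint.mono hgc.aestronglyMeasurable (.of_forall fun x ↦ ?_)
      simp only [hg]
      rw [norm_mul, hnorm, one_mul]
    have hgn : ∀ (x : Fin d → ℝ) (n : Fin d → ℤ), g (x + fun i ↦ (n i : ℝ)) =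
        Complex.exp (-(2 * Real.pi * Complex.I * ∑ i, k i * x i)) * f (x + fun i ↦ (n i : ℝ)) := by
      intro x n
      simp only [hg]
      congr 1
      rw [Complex.exp_eq_exp_iff_exists_int]
      refine ⟨-∑ i, k i * n i, ?_⟩
      simp only [Pi.add_apply, Complex.ofReal_add, mul_add, Finset.sum_add_distrib]
      push_cast
      ring
    rw [UnitAddTorus.mFourierCoeff_eq_integral _ _ (fun _ ↦ 0)]
    change _ = ∫ x, g x
    rw [integral_eq_tsum_integral_unit_cube hgi]
    obtain ⟨u, hu1, hu2⟩ := hu 1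
    have hmeas : MeasurableSet {x : Fin d → ℝ | ∀ i, x i ∈ Set.Ioc (0 : ℝ) (0 + 1)} := by
      have : {x : Fin d → ℝ | ∀ i, x i ∈ Set.Ioc (0 : ℝ) (0 + 1)} =
        Set.univ.pi fun i ↦ Set.Ioc (0 : ℝ) (0 + 1) := by ext; simp
      rw [this]
      exact MeasurableSet.univ_pi fun i ↦ measurableSet_Ioc
    have hvol : volume.real {x : Fin d → ℝ | ∀ i, x i ∈ Set.Ioc (0 : ℝ) (0 + 1)} = 1 := by
      have : {x : Fin d → ℝ | ∀ i, x i ∈ Set.Ioc (0 : ℝ) (0 + 1)} =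
        Set.univ.pi fun i ↦ Set.Ioc (0 : ℝ) (0 + 1) := by ext; simp
      rw [this, Measure.real, volume_pi_pi]
      simp
    have hfin : volume {x : Fin d → ℝ | ∀ i, x i ∈ Set.Ioc (0 : ℝ) (0 + 1)} ≠ ⊤ := fun h ↦ by
      rw [Measure.real, h] at hvol
      simp at hvol
    have hbd : ∀ (n : Fin d → ℤ) (x : Fin d → ℝ),
        x ∈ {x : Fin d → ℝ | ∀ i, x i ∈ Set.Ioc (0 : ℝ) (0 + 1)} →
          ‖g (x + fun i ↦ (n i : ℝ))‖ ≤ u n := by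
      intro n x hx
      rw [hgn, norm_mul, hnorm, one_mul]
      refine hu2 n x ((pi_norm_le_iff_of_nonneg zero_le_one).mpr fun i ↦ ?_)
      have := hx i
      rw [Real.norm_eq_abs, abs_le]
      constructor <;> linarith [this.1, this.2]
    rw [integral_tsum_of_summable_integral_norm (F := fun (n : Fin d → ℤ) x ↦ g (x + fun i ↦ (n i : ℝ)))]
    · refine setIntegral_congr_fun hmeas fun x _ ↦ ?_
      simp only [hGapp, hgn, tsum_mul_left, hexp, smul_eq_mul]
      congr 2
      simp
    · intro n
      exact (hgi.comp_add_right _).integrableOn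
    · refine Summable.of_nonneg_of_le (fun n ↦ integral_nonneg fun x ↦ norm_nonneg _) (fun n ↦ ?_) hu1
      have := setIntegral_mono_on (hgi.comp_add_right _).norm.integrableOn
        (integrableOn_const (C := u n) hfin) hmeas (hbd n)
      rwa [setIntegral_const, hvol, one_smul] at this
  have hsum : Summable (UnitAddTorus.mFourierCoeff G) := by
    refine hF.congr fun k ↦ ?_
    rw [hcoef]
  have := UnitAddTorus.hasSum_mFourier_series_apply_of_summable hsum fun i ↦ (y i : UnitAddCircle)
  rw [hGapp] at this
  change Φ y = _
  rw [← this.tsum_eq]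
  refine tsum_congr fun k ↦ ?_
  rw [hcoef, hexp, smul_eq_mul]

lemma summable_prod_pi {d : ℕ} {g : ℤ → ℝ} (hg : Summable g) (h0 : ∀ n, 0 ≤ g n) :
    Summable fun n : Fin d → ℤ ↦ ∏ i, g (n i) := by
  induction d with
  | zero => exact Summable.of_finite
  | succ d ih =>
    rw [← (Fin.consEquiv fun _ : Fin (d + 1) ↦ ℤ).summable_iff]
    refine (hg.mul_of_nonneg ih h0 fun n ↦ Finset.prod_nonneg fun i _ ↦ h0 _).congr fun n ↦ ?_
    simp [Fin.prod_univ_succ, Fin.consEquiv]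

lemma summable_exp_neg_mul_int_sq {c : ℝ} (hc : 0 < c) :
    Summable fun n : ℤ ↦ Real.exp (-c * (n : ℝ) ^ 2) := by
  have h : Summable fun n : ℕ ↦ Real.exp (-c * ((n : ℤ) : ℝ) ^ 2) := by
    refine Summable.of_nonneg_of_le (fun n ↦ (Real.exp_pos _).le) (fun n ↦ ?_)
      (summable_geometric_of_lt_one (Real.exp_pos (-c)).le
        (Real.exp_lt_one_iff.mpr (by linarith)))
    rw [← Real.exp_nat_mul, Real.exp_le_exp]
    have : (n : ℝ) ≤ (n : ℝ) ^ 2 := by exact_mod_cast Nat.le_self_pow two_ne_zero n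
    push_cast
    nlinarith
  exact summable_int_iff_summable_nat_and_neg.2 ⟨h, by simpa using h⟩

lemma summable_exp_neg_mul_dotProduct_int {d : ℕ} {c : ℝ} (hc : 0 < c) :
    Summable fun n : Fin d → ℤ ↦ Real.exp (-c * ∑ i, (n i : ℝ) ^ 2) := by
  refine (summable_prod_pi (summable_exp_neg_mul_int_sq hc) fun n ↦ (Real.exp_pos _).le).congr fun n ↦ ?_
  rw [← Real.exp_sum, Finset.mul_sum]

open Matrix in
lemma exists_le_mulVec_dotProduct {d : ℕ} {M N : Matrix (Fin d) (Fin d) ℝ} (h : N * M = 1) :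
    ∃ δ : ℝ, 0 < δ ∧ ∀ x, δ * ∑ i, x i ^ 2 ≤ (M *ᵥ x) ⬝ᵥ (M *ᵥ x) := by
  set K : ℝ := ∑ i, ∑ j, N i j ^ 2 + 1 with hK
  have hK0 : 0 < K := by positivity
  refine ⟨K⁻¹, inv_pos.mpr hK0, fun x ↦ ?_⟩
  rw [inv_mul_le_iff₀ hK0]
  set v := M *ᵥ x with hv
  have hx : x = N *ᵥ v := by rw [hv, mulVec_mulVec, h, one_mulVec]
  have hvv : v ⬝ᵥ v = ∑ j, v j ^ 2 := by simp [dotProduct, sq]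
  have h0 : 0 ≤ ∑ j, v j ^ 2 := by positivity
  calc ∑ i, x i ^ 2 = ∑ i, (∑ j, N i j * v j) ^ 2 := by rw [hx]; rfl
    _ ≤ ∑ i, (∑ j, N i j ^ 2) * ∑ j, v j ^ 2 :=
      Finset.sum_le_sum fun i _ ↦ Finset.sum_mul_sq_le_sq_mul_sq _ _ _
    _ = (∑ i, ∑ j, N i j ^ 2) * ∑ j, v j ^ 2 := by rw [Finset.sum_mul]
    _ ≤ K * (v ⬝ᵥ v) := by rw [hvv]; gcongr; linarith

open Matrix in
lemma summable_exp_neg_mulVec_add {d : ℕ} {M N : Matrix (Fin d) (Fin d) ℝ} (h : N * M = 1)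
    {c : ℝ} (hc : 0 < c) (R : ℝ) :
    ∃ u : (Fin d → ℤ) → ℝ, Summable u ∧ ∀ (n : Fin d → ℤ) (y : Fin d → ℝ), ‖y‖ ≤ R →
      Real.exp (-c * ((M *ᵥ (y + fun i ↦ (n i : ℝ))) ⬝ᵥ (M *ᵥ (y + fun i ↦ (n i : ℝ))))) ≤ u n := by
  obtain ⟨δ, hδ, hM⟩ := exists_le_mulVec_dotProduct h
  refine ⟨fun n ↦ Real.exp (c * δ * (d * R ^ 2)) * Real.exp (-(c * δ / 2) * ∑ i, (n i : ℝ) ^ 2),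
    (summable_exp_neg_mul_dotProduct_int (by positivity)).mul_left _, fun n y hy ↦ ?_⟩
  beta_reduce
  rw [← Real.exp_add, Real.exp_le_exp]
  have h1 : ∑ i : Fin d, ((n i : ℝ) ^ 2 / 2 - R ^ 2) ≤ ∑ i, (y i + n i) ^ 2 := by
    refine Finset.sum_le_sum fun i _ ↦ ?_
    have h2 : |y i| ≤ R := (norm_le_pi_norm y i).trans hy
    have h3 : y i ^ 2 ≤ R ^ 2 := sq_le_sq' (by linarith [abs_le.mp h2]) (abs_le.mp h2).2
    nlinarith [sq_nonneg (n i + 2 * y i : ℝ)]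
  rw [Finset.sum_sub_distrib, ← Finset.sum_div] at h1
  simp only [Finset.sum_const, Finset.card_univ, Fintype.card_fin, nsmul_eq_mul] at h1
  have h4 := hM (y + fun i ↦ (n i : ℝ))
  have h5 := mul_le_mul_of_nonneg_left h1 hδ.le
  have h6 := mul_le_mul_of_nonneg_left (h5.trans h4) hc.le
  simp only [neg_mul]
  linarith

open Matrix MeasureTheory in
/-- Poisson summation for Gaussians on the lattice spanned by the columns of an invertible matrix. -/
theorem tsum_exp_mulVec_eq {d : ℕ} {M N : Matrix (Fin d) (Fin d) ℝ} (h : N * M = 1) {w : ℂ}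
    (hw : 0 < w.re) (s : Fin d → ℝ) :
    ∑' n : Fin d → ℤ, Complex.exp (-(Real.pi * w) *
        (((M *ᵥ (fun i ↦ (n i : ℝ)) + s) ⬝ᵥ (M *ᵥ (fun i ↦ (n i : ℝ)) + s) : ℝ) : ℂ)) =
      (|M.det|⁻¹ : ℝ) * (1 / w) ^ (d / 2 : ℂ) * ∑' k : Fin d → ℤ, Complex.exp (-(Real.pi / w) *
        (((Nᵀ *ᵥ (fun i ↦ (k i : ℝ))) ⬝ᵥ (Nᵀ *ᵥ (fun i ↦ (k i : ℝ))) : ℝ) : ℂ)) *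
          Complex.exp (2 * Real.pi * Complex.I * (((Nᵀ *ᵥ (fun i ↦ (k i : ℝ))) ⬝ᵥ s : ℝ) : ℂ)) := by
  have hMN : M * N = 1 := mul_eq_one_comm.mp h
  have hw0 : w ≠ 0 := fun h ↦ by simp [h] at hw
  have hb : 0 < (Real.pi * w : ℂ).re := by
    rw [Complex.re_ofReal_mul]; exact mul_pos Real.pi_pos hw
  have hdet : M.det ≠ 0 := fun h0 ↦ by
    have := congrArg Matrix.det h
    simp [h0] at this
  set φ : (Fin d → ℝ) → ℂ := fun v ↦ Complex.exp (-(Real.pi * w) * ((v ⬝ᵥ v : ℝ) : ℂ)) with hφ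
  have hφn : ∀ v, ‖φ v‖ = Real.exp (-(Real.pi * w.re) * (v ⬝ᵥ v)) := fun v ↦ by
    simp [hφ, Complex.norm_exp]
  have hφc : Continuous φ := by simp only [hφ, dotProduct]; fun_prop
  have hφg : ∀ (c : Fin d → ℂ) (v : Fin d → ℝ), Complex.exp (∑ i, c i * v i) * φ v =
      Complex.exp (-(Real.pi * w) * ∑ i, (v i : ℂ) ^ 2 + ∑ i, c i * v i) := fun c v ↦ by
    rw [add_comm, Complex.exp_add]
    simp [hφ, dotProduct, sq]
  have hφi : Integrable φ := by
    have := GaussianFourier.integrable_cexp_neg_mul_sum_add hb (fun _ : Fin d ↦ 0)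
    refine this.congr (.of_forall fun v ↦ ?_)
    change Complex.exp _ = φ v
    rw [← hφg]
    simp
  have hemb : MeasurableEmbedding (toLin' M) :=
    ((LinearEquiv.ofLinearMap (toLin' M) (toLin' N) (by rw [← toLin'_mul, hMN, toLin'_one])
      (by rw [← toLin'_mul, h, toLin'_one])).toContinuousLinearEquiv).toHomeomorph.measurableEmbedding
  have hmap : Measure.map (toLin' M) volume = ENNReal.ofReal |M.det⁻¹| • volume :=
    Real.map_matrix_volume_pi_eq_smul_volume_pi hdet
  have hchange : ∀ F : (Fin d → ℝ) → ℂ, ∫ x, F (M *ᵥ x) = (|M.det|⁻¹ : ℝ) * ∫ v, F v := by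
    intro F
    have h1 := hemb.integral_map (μ := volume) F
    rw [hmap, integral_smul_measure, ENNReal.toReal_ofReal (abs_nonneg _), abs_inv,
      Complex.real_smul] at h1
    exact h1.symm
  have hchangei : Integrable fun x ↦ φ (M *ᵥ x) := by
    have h1 := hemb.integrable_map_iff (μ := volume) (g := φ)
    rw [hmap] at h1
    exact h1.mp (hφi.smul_measure ENNReal.ofReal_ne_top)
  have hcoef : ∀ k : Fin d → ℤ, (∫ x : Fin d → ℝ,
      Complex.exp (-(2 * Real.pi * Complex.I * ∑ i, k i * x i)) * φ (M *ᵥ x)) =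
      (|M.det|⁻¹ : ℝ) * ((1 / w) ^ (d / 2 : ℂ) * Complex.exp (-(Real.pi / w) *
        (((Nᵀ *ᵥ (fun i ↦ (k i : ℝ))) ⬝ᵥ (Nᵀ *ᵥ (fun i ↦ (k i : ℝ))) : ℝ) : ℂ))) := by
    intro k
    set κ := Nᵀ *ᵥ (fun i ↦ (k i : ℝ)) with hκ
    have h1 : ∀ x : Fin d → ℝ, (∑ i, k i * x i : ℝ) = κ ⬝ᵥ (M *ᵥ x) := fun x ↦ by
      rw [hκ, dotProduct_mulVec, mulVec_transpose, vecMul_vecMul, h, vecMul_one]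
      rfl
    simp only [h1]
    rw [hchange fun v ↦ Complex.exp (-(2 * Real.pi * Complex.I * (κ ⬝ᵥ v : ℝ))) * φ v]
    congr 1
    have h2 : ∀ v, Complex.exp (-(2 * Real.pi * Complex.I * (κ ⬝ᵥ v : ℝ))) * φ v =
        Complex.exp (-(Real.pi * w) * ∑ i, (v i : ℂ) ^ 2 +
          ∑ i, (-(2 * Real.pi * Complex.I) * κ i) * v i) := fun v ↦ by
      rw [← hφg]
      congr 2
      simp only [dotProduct, Complex.ofReal_sum, Complex.ofReal_mul, Finset.mul_sum,
        ← Finset.sum_neg_distrib]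
      exact Finset.sum_congr rfl fun i _ ↦ by ring
    simp only [h2]
    rw [GaussianFourier.integral_cexp_neg_mul_sum_add hb, Fintype.card_fin]
    have hpi : (Real.pi : ℂ) ≠ 0 := by exact_mod_cast Real.pi_ne_zero
    congr 2
    · field_simp
    · simp only [mul_pow, ← Finset.mul_sum, dotProduct, Complex.ofReal_sum, Complex.ofReal_pow, ← sq,
        neg_sq, Complex.I_sq]
      field_simp
      ring
  have hsumF : Summable fun k : Fin d → ℤ ↦ Complex.exp (-(Real.pi / w) *
        (((Nᵀ *ᵥ (fun i ↦ (k i : ℝ))) ⬝ᵥ (Nᵀ *ᵥ (fun i ↦ (k i : ℝ))) : ℝ) : ℂ)) := by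
    have hc : 0 < (Real.pi / w : ℂ).re := by
      rw [div_eq_mul_inv, Complex.re_ofReal_mul, Complex.inv_re]
      exact mul_pos Real.pi_pos (div_pos hw (Complex.normSq_pos.mpr hw0))
    have hT : Mᵀ * Nᵀ = 1 := by rw [← transpose_mul, h, transpose_one]
    obtain ⟨u, hu1, hu2⟩ := summable_exp_neg_mulVec_add hT hc 0
    refine Summable.of_norm_bounded hu1 fun k ↦ ?_
    have := hu2 k 0 (by simp)
    simpa [Complex.norm_exp] using this
  have key := tsum_add_int_eq_tsum_fourier (f := fun x ↦ φ (M *ᵥ x))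
    (hφc.comp (by fun_prop)) hchangei (fun R ↦ by
      obtain ⟨u, hu1, hu2⟩ := summable_exp_neg_mulVec_add h (mul_pos Real.pi_pos hw) R
      exact ⟨u, hu1, fun n y hy ↦ (hφn _).trans_le (hu2 n y hy)⟩)
    (by simp only [hcoef]; exact (hsumF.mul_left _).mul_left _) (N *ᵥ s)
  simp only [hcoef] at key
  have hl : ∀ n : Fin d → ℤ, M *ᵥ (N *ᵥ s + fun i ↦ (n i : ℝ)) = M *ᵥ (fun i ↦ (n i : ℝ)) + s :=
    fun n ↦ by rw [mulVec_add, mulVec_mulVec, hMN, one_mulVec, add_comm]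
  have hr : ∀ k : Fin d → ℤ, (∑ i, k i * (N *ᵥ s) i : ℝ) = (Nᵀ *ᵥ (fun i ↦ (k i : ℝ))) ⬝ᵥ s :=
    fun k ↦ by
      rw [mulVec_transpose, ← dotProduct_mulVec]
      rfl
  simp only [hl, hr, mul_assoc, tsum_mul_left] at key
  simpa only [mul_assoc] using key

open Matrix in
lemma exists_basisMatrix {d : ℕ} (L : AddSubgroup (Fin d → ℝ))
    (hL : ∀ v, v ∈ L ↔ ∀ w ∈ L, ∃ m : ℤ, v ⬝ᵥ w = m) (hmin : ∀ x ∈ L, x ≠ 0 → 1 ≤ x ⬝ᵥ x) :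
    ∃ M N : Matrix (Fin d) (Fin d) ℝ, N * M = 1 ∧
      (∀ x, x ∈ L ↔ ∃ n : Fin d → ℤ, M *ᵥ (fun i ↦ (n i : ℝ)) = x) ∧
      (∀ x, x ∈ L ↔ ∃ k : Fin d → ℤ, Nᵀ *ᵥ (fun i ↦ (k i : ℝ)) = x) := by
  set Λ : Submodule ℤ (Fin d → ℝ) := AddSubgroup.toIntSubmodule L with hΛ
  have hmem : ∀ x, x ∈ Λ ↔ x ∈ L := fun x ↦ Iff.rfl
  have hdisc : DiscreteTopology Λ := by
    refine DiscreteTopology.of_forall_le_norm (r := 1 / (d + 1)) (by positivity) fun x hx ↦ ?_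
    by_contra! hlt
    have h1 := hmin x x.2 (by simpa using hx)
    have h2 : (x : Fin d → ℝ) ⬝ᵥ x ≤ ∑ _i : Fin d, (1 / (d + 1 : ℝ)) ^ 2 := by
      refine Finset.sum_le_sum fun i _ ↦ ?_
      have := (norm_le_pi_norm (x : Fin d → ℝ) i).trans hlt.le
      rw [Real.norm_eq_abs] at this
      rw [← sq]
      exact sq_le_sq' (by linarith [abs_le.mp this]) (abs_le.mp this).2
    have h3 : ∑ _i : Fin d, (1 / (d + 1 : ℝ)) ^ 2 < 1 := by
      simp only [Finset.sum_const, Finset.card_univ, Fintype.card_fin, nsmul_eq_mul]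
      rw [div_pow, one_pow, mul_one_div, div_lt_one (by positivity)]
      nlinarith [(Nat.cast_nonneg d : (0 : ℝ) ≤ d)]
    linarith
  have hspan : Submodule.span ℝ (Λ : Set (Fin d → ℝ)) = ⊤ := by
    by_contra hne
    obtain ⟨f, hf0, hf⟩ := Submodule.exists_le_ker_of_lt_top _ (lt_top_iff_ne_top.mpr hne)
    set v : Fin d → ℝ := fun i ↦ f (Pi.single i 1) with hv
    have hfv : ∀ x, f x = v ⬝ᵥ x := fun x ↦ by
      rw [LinearMap.pi_apply_eq_sum_univ f x]
      simp only [hv, dotProduct, smul_eq_mul]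
      refine Finset.sum_congr rfl fun i _ ↦ ?_
      rw [mul_comm]
      congr 2
      ext j
      simp [Pi.single_apply, eq_comm]
    have hv0 : v ≠ 0 := fun h ↦ hf0 (LinearMap.ext fun x ↦ by simp [hfv, h])
    have hvv : 0 < v ⬝ᵥ v := by
      refine lt_of_le_of_ne (Finset.sum_nonneg fun i _ ↦ mul_self_nonneg _) fun h ↦ hv0 ?_
      exact dotProduct_self_eq_zero.mp h.symm
    set t : ℝ := 1 / (1 + v ⬝ᵥ v) with ht
    have ht0 : 0 < t := by positivity
    have htv : t • v ∈ L := (hL _).mpr fun w hw ↦ ⟨0, by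
      have : f w = 0 := hf (Submodule.subset_span hw)
      rw [smul_dotProduct, ← hfv, this]
      simp⟩
    have h1 := hmin _ htv (smul_ne_zero ht0.ne' hv0)
    rw [smul_dotProduct, dotProduct_smul, smul_eq_mul, smul_eq_mul] at h1
    have h2 : t * (1 + v ⬝ᵥ v) = 1 := by rw [ht]; field_simp
    nlinarith [mul_pos ht0 hvv]
  have hlat : IsZLattice ℝ Λ := ⟨hspan⟩
  have hrank : Module.finrank ℤ Λ = d := by
    rw [ZLattice.rank ℝ Λ, Module.finrank_fin_fun]
  let b : Module.Basis (Fin d) ℤ Λ := (Module.finBasis ℤ Λ).reindex (finCongr hrank)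
  let B : Module.Basis (Fin d) ℝ (Fin d → ℝ) := b.ofZLatticeBasis ℝ Λ
  set M := (Pi.basisFun ℝ (Fin d)).toMatrix B with hM
  set N := B.toMatrix (Pi.basisFun ℝ (Fin d)) with hN
  have hNM : N * M = 1 := Module.Basis.toMatrix_mul_toMatrix_flip _ _
  have hMN : M * N = 1 := Module.Basis.toMatrix_mul_toMatrix_flip _ _
  have hMn : ∀ n : Fin d → ℤ, M *ᵥ (fun i ↦ (n i : ℝ)) = ((∑ j, n j • b j : Λ) : Fin d → ℝ) := by
    intro n
    ext i
    simp [mulVec, dotProduct, hM, Module.Basis.toMatrix_apply, B, mul_comm]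
  have hM' : ∀ x, x ∈ L ↔ ∃ n : Fin d → ℤ, M *ᵥ (fun i ↦ (n i : ℝ)) = x := by
    intro x
    refine ⟨fun hx ↦ ⟨fun j ↦ b.repr ⟨x, hx⟩ j, ?_⟩, fun ⟨n, hn⟩ ↦ ?_⟩
    · rw [hMn, b.sum_repr]
    · rw [← hn, hMn]
      exact (∑ j, n j • b j : Λ).2
  refine ⟨M, N, hNM, hM', fun x ↦ ⟨fun hx ↦ ?_, fun ⟨k, hk⟩ ↦ ?_⟩⟩
  · choose k hk using fun j : Fin d ↦ (hL x).mp hx (b j) (b j).2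
    refine ⟨k, ?_⟩
    have h1 : (fun i ↦ (k i : ℝ)) = Mᵀ *ᵥ x := by
      ext j
      rw [← hk, dotProduct_comm]
      simp [mulVec, dotProduct, hM, Module.Basis.toMatrix_apply, B]
    rw [h1, mulVec_mulVec, ← transpose_mul, hMN, transpose_one, one_mulVec]
  · refine (hL x).mpr fun w hw ↦ ?_
    obtain ⟨n, rfl⟩ := (hM' w).mp hw
    refine ⟨∑ i, k i * n i, ?_⟩
    rw [← hk, dotProduct_mulVec, mulVec_transpose, vecMul_vecMul, hNM, vecMul_one]
    simp [dotProduct]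

/-- Three holomorphic functions on the upper half plane which transform among themselves like the
theta series of an odd unimodular lattice, its alternating theta series and that of its shadow. -/
structure ThetaTriple (k : ℕ) (A B C : ℂ → ℂ) : Prop where
  differentiableOn_left : DifferentiableOn ℂ A {z | 0 < z.im}
  differentiableOn_mid : DifferentiableOn ℂ B {z | 0 < z.im}
  differentiableOn_right : DifferentiableOn ℂ C {z | 0 < z.im}
  left_add_one : ∀ z : ℂ, 0 < z.im → A (z + 1) = B z
  mid_add_one : ∀ z : ℂ, 0 < z.im → B (z + 1) = A z
  right_add_one : ∀ z : ℂ, 0 < z.im → C (z + 1) = -C z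
  left_neg_inv : ∀ z : ℂ, 0 < z.im → A (-1 / z) = -z ^ k * A z
  mid_neg_inv : ∀ z : ℂ, 0 < z.im → B (-1 / z) = -z ^ k * C z
  right_neg_inv : ∀ z : ℂ, 0 < z.im → C (-1 / z) = -z ^ k * B z

lemma im_neg_one_div_pos {z : ℂ} (hz : 0 < z.im) : 0 < (-1 / z).im := by
  have hz0 : z ≠ 0 := fun h ↦ by simp [h] at hz
  rw [neg_div, Complex.neg_im, one_div, Complex.inv_im]
  have := Complex.normSq_pos.mpr hz0
  rw [neg_div, neg_neg]
  positivity

open Matrix in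
lemma exists_characteristic_vector {d : ℕ} (L : AddSubgroup (Fin d → ℝ))
    (hL : ∀ v, v ∈ L ↔ ∀ w ∈ L, ∃ m : ℤ, v ⬝ᵥ w = m) (hmin : ∀ x ∈ L, x ≠ 0 → 1 ≤ x ⬝ᵥ x) :
    ∃ s : Fin d → ℝ, ∀ x ∈ L, ∃ m : ℤ, 2 * (x ⬝ᵥ s) = x ⬝ᵥ x + 2 * m := by
  obtain ⟨M, N, hNM, hM, -⟩ := exists_basisMatrix L hL hmin
  set s := Nᵀ *ᵥ fun j ↦ (Mᵀ j ⬝ᵥ Mᵀ j) / 2 with hs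
  refine ⟨s, fun x hx ↦ ?_⟩
  have hcol : ∀ j, Mᵀ j = M *ᵥ (Pi.single j 1) := fun j ↦ by
    rw [mulVec_single_one]; rfl
  let H : AddSubgroup (Fin d → ℝ) :=
    { carrier := {x | x ∈ L ∧ ∃ m : ℤ, 2 * (x ⬝ᵥ s) = x ⬝ᵥ x + 2 * m}
      zero_mem' := ⟨L.zero_mem, 0, by simp⟩
      add_mem' := by
        rintro x y ⟨hx, m, hm⟩ ⟨hy, n, hn⟩
        obtain ⟨k, hk⟩ := (hL x).mp hx y hy
        refine ⟨L.add_mem hx hy, m + n - k, ?_⟩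
        simp only [add_dotProduct, dotProduct_add, dotProduct_comm y x, hk]
        push_cast
        linarith
      neg_mem' := by
        rintro x ⟨hx, m, hm⟩
        obtain ⟨k, hk⟩ := (hL x).mp hx x hx
        refine ⟨L.neg_mem hx, -m - k, ?_⟩
        simp only [neg_dotProduct, dotProduct_neg, neg_neg, hk] at hm ⊢
        push_cast
        linarith }
  have hb : ∀ j, Mᵀ j ∈ H := fun j ↦ by
    refine ⟨(hM _).mpr ⟨Pi.single j 1, ?_⟩, 0, ?_⟩
    · rw [hcol]
      congr 1
      ext i
      simp [Pi.single_apply]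
    · rw [hs, dotProduct_comm, mulVec_transpose, ← dotProduct_mulVec, hcol j, mulVec_mulVec, hNM,
        one_mulVec, dotProduct_single, hcol j]
      simp
      ring
  obtain ⟨n, rfl⟩ := (hM x).mp hx
  have : M *ᵥ (fun i ↦ (n i : ℝ)) = ∑ j, n j • Mᵀ j := by
    ext i
    simp [mulVec, dotProduct, mul_comm]
  have hxH : M *ᵥ (fun i ↦ (n i : ℝ)) ∈ H := by
    rw [this]
    exact sum_mem fun j _ ↦ H.zsmul_mem (hb j) _
  exact hxH.2

open Matrix in
lemma summable_exp_neg_selfDual {d : ℕ} (L : AddSubgroup (Fin d → ℝ))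
    (hL : ∀ v, v ∈ L ↔ ∀ w ∈ L, ∃ m : ℤ, v ⬝ᵥ w = m) (hmin : ∀ x ∈ L, x ≠ 0 → 1 ≤ x ⬝ᵥ x)
    {c : ℝ} (hc : 0 < c) (s : Fin d → ℝ) :
    Summable fun x : L ↦ Real.exp (-c * ((x.1 + s) ⬝ᵥ (x.1 + s))) := by
  obtain ⟨M, N, hNM, hM, -⟩ := exists_basisMatrix L hL hmin
  have hMN : M * N = 1 := mul_eq_one_comm.mp hNM
  obtain ⟨u, hu1, hu2⟩ := summable_exp_neg_mulVec_add hNM hc ‖N *ᵥ s‖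
  let e : L → (Fin d → ℤ) := fun x ↦ ((hM x).mp x.2).choose
  have he : ∀ x : L, M *ᵥ (fun i ↦ (e x i : ℝ)) = x := fun x ↦ ((hM x).mp x.2).choose_spec
  have hinj : Function.Injective e := fun x y hxy ↦ Subtype.ext (by rw [← he x, ← he y, hxy])
  refine Summable.of_nonneg_of_le (fun x ↦ (Real.exp_pos _).le) (fun x ↦ ?_)
    (hu1.comp_injective hinj)
  have := hu2 (e x) (N *ᵥ s) le_rfl
  rwa [mulVec_add, mulVec_mulVec, hMN, one_mulVec, he, add_comm s] at this

open Matrix in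
/-- The theta inversion formula for a translate of a self-dual lattice in dimension `36`. -/
lemma tsum_exp_selfDual (L : AddSubgroup (Fin 36 → ℝ))
    (hL : ∀ v, v ∈ L ↔ ∀ w ∈ L, ∃ m : ℤ, v ⬝ᵥ w = m) (hmin : ∀ x ∈ L, x ≠ 0 → 1 ≤ x ⬝ᵥ x)
    (s : Fin 36 → ℝ) {z : ℂ} (hz : 0 < z.im) :
    ∑' x : L, Complex.exp (Real.pi * Complex.I * z * (((x.1 + s) ⬝ᵥ (x.1 + s) : ℝ) : ℂ)) =
      -(z ^ 18)⁻¹ * ∑' x : L, Complex.exp (Real.pi * Complex.I * (-1 / z) *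
        ((x.1 ⬝ᵥ x.1 : ℝ) : ℂ)) * Complex.exp (2 * Real.pi * Complex.I * ((x.1 ⬝ᵥ s : ℝ) : ℂ)) := by
  obtain ⟨M, N, hNM, hM, hN⟩ := exists_basisMatrix L hL hmin
  have hMN : M * N = 1 := mul_eq_one_comm.mp hNM
  have hMN' : Mᵀ * Nᵀ = 1 := by rw [← transpose_mul, hNM, transpose_one]
  have hequiv : ∀ P Q : Matrix (Fin 36) (Fin 36) ℝ, Q * P = 1 →
      (∀ x, x ∈ L ↔ ∃ n : Fin 36 → ℤ, P *ᵥ (fun i ↦ (n i : ℝ)) = x) →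
      ∃ e : (Fin 36 → ℤ) ≃ L, ∀ n, (e n : Fin 36 → ℝ) = P *ᵥ (fun i ↦ (n i : ℝ)) := by
    intro P Q hQP hP
    refine ⟨Equiv.ofBijective (fun n ↦ ⟨P *ᵥ (fun i ↦ (n i : ℝ)), (hP _).mpr ⟨n, rfl⟩⟩) ⟨?_, ?_⟩,
      fun n ↦ rfl⟩
    · intro n m hnm
      have h1 := congrArg (fun x : L ↦ Q *ᵥ (x : Fin 36 → ℝ)) hnm
      simp only [mulVec_mulVec, hQP, one_mulVec] at h1
      ext i
      exact_mod_cast congrFun h1 i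
    · intro x
      obtain ⟨n, hn⟩ := (hP x).mp x.2
      exact ⟨n, Subtype.ext hn⟩
  obtain ⟨e, he⟩ := hequiv M N hNM hM
  obtain ⟨e', he'⟩ := hequiv Nᵀ Mᵀ hMN' hN
  have hgen : ∀ {z : ℂ}, 0 < z.im → ∀ s : Fin 36 → ℝ,
      ∑' x : L, Complex.exp (Real.pi * Complex.I * z * (((x.1 + s) ⬝ᵥ (x.1 + s) : ℝ) : ℂ)) =
      (|M.det|⁻¹ : ℝ) * (-(z ^ 18)⁻¹ * ∑' x : L, Complex.exp (Real.pi * Complex.I * (-1 / z) *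
        ((x.1 ⬝ᵥ x.1 : ℝ) : ℂ)) *
          Complex.exp (2 * Real.pi * Complex.I * ((x.1 ⬝ᵥ s : ℝ) : ℂ))) := by
    intro z hz s
    have hz0 : z ≠ 0 := fun h ↦ by simp [h] at hz
    have hw : 0 < (-Complex.I * z).re := by simpa using hz
    have key := tsum_exp_mulVec_eq hNM hw s
    rw [← e.tsum_eq, ← e'.tsum_eq]
    simp only [he, he']
    have h1 : -(Real.pi * (-Complex.I * z)) = Real.pi * Complex.I * z := by ring
    have h2 : -(Real.pi / (-Complex.I * z)) = Real.pi * Complex.I * (-1 / z) := by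
      field_simp
      simp
    have h3 : (1 / (-Complex.I * z)) ^ (((36 : ℕ) : ℂ) / 2) = -(z ^ 18)⁻¹ := by
      rw [show (((36 : ℕ) : ℂ) / 2) = ((18 : ℕ) : ℂ) by norm_num, Complex.cpow_natCast, div_pow,
        mul_pow]
      have : (-Complex.I) ^ 18 = -1 := by
        rw [show 18 = 2 * 9 by norm_num, pow_mul, neg_sq, Complex.I_sq]; norm_num
      rw [this]
      field_simp
    rw [h1, h2, h3] at key
    rw [key, mul_assoc]
  have hκ : ((|M.det|⁻¹ : ℝ) : ℂ) = 1 := by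
    have h0 := hgen (z := Complex.I) (by simp) 0
    have h1 : ∀ x : Fin 36 → ℝ, Complex.exp (Real.pi * Complex.I * Complex.I * ((x ⬝ᵥ x : ℝ) : ℂ)) =
        (Real.exp (-Real.pi * (x ⬝ᵥ x)) : ℝ) := fun x ↦ by
      rw [mul_assoc (Real.pi : ℂ), Complex.I_mul_I]
      push_cast
      congr 1
      ring
    have h2 : (-1 / Complex.I) = Complex.I := by
      rw [div_eq_iff Complex.I_ne_zero, Complex.I_mul_I]
    have h3 : -(Complex.I ^ 18)⁻¹ = 1 := by
      rw [show 18 = 2 * 9 by norm_num, pow_mul, Complex.I_sq]; norm_num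
    simp only [h2, h3, add_zero, h1, dotProduct_zero, Complex.ofReal_zero, mul_zero, Complex.exp_zero,
      mul_one, one_mul, ← Complex.ofReal_tsum] at h0
    have h4 := summable_exp_neg_selfDual L hL hmin Real.pi_pos 0
    simp only [add_zero] at h4
    have h5 : 0 < ∑' x : L, Real.exp (-Real.pi * (x.1 ⬝ᵥ x.1)) :=
      h4.tsum_pos (fun x ↦ (Real.exp_pos _).le) 0 (Real.exp_pos _)
    have h6 : ((∑' x : L, Real.exp (-Real.pi * (x.1 ⬝ᵥ x.1)) : ℝ) : ℂ) ≠ 0 := by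
      exact_mod_cast h5.ne'
    exact mul_right_cancel₀ h6 (by rw [one_mul]; exact h0.symm)
  rw [hgen hz s, hκ, one_mul]

lemma exp_pi_I_mul_pow (z : ℂ) (n : ℕ) :
    Complex.exp (Real.pi * Complex.I * z) ^ n = Complex.exp (Real.pi * Complex.I * z * ((n : ℝ) : ℂ)) := by
  rw [← Complex.exp_nat_mul]
  congr 1
  push_cast
  ring

lemma exp_pi_I_mul_natCast (n : ℕ) : Complex.exp (Real.pi * Complex.I * ((n : ℝ) : ℂ)) = (-1) ^ n := by
  rw [← Complex.exp_pi_mul_I, ← Complex.exp_nat_mul]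
  congr 1
  push_cast
  ring

lemma qSeries_one_add_one {ι : Type*} (ν : ι → ℕ) (z : ℂ) :
    qSeries (fun _ ↦ 1) ν (z + 1) = qSeries (fun i ↦ (-1) ^ ν i) ν z := by
  refine tsum_congr fun i ↦ ?_
  rw [mul_add, Complex.exp_add, mul_pow, mul_one, Complex.exp_pi_mul_I]
  ring

lemma qSeries_neg_one_add_one {ι : Type*} (ν : ι → ℕ) (z : ℂ) :
    qSeries (fun i ↦ (-1) ^ ν i) ν (z + 1) = qSeries (fun _ ↦ 1) ν z := by
  refine tsum_congr fun i ↦ ?_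
  rw [mul_add, Complex.exp_add, mul_pow, mul_one, Complex.exp_pi_mul_I, mul_left_comm, ← mul_pow]
  simp

lemma summable_pow_of_summable_exp {ι : Type*} {ν : ι → ℕ}
    (h : ∀ c : ℝ, 0 < c → Summable fun i ↦ Real.exp (-c * ν i)) (r : ℝ) (hr0 : 0 ≤ r) (hr1 : r < 1) :
    Summable fun i ↦ r ^ ν i := by
  set t := (r + 1) / 2 with ht
  have ht0 : 0 < t := by rw [ht]; linarith
  have hlog : 0 < -Real.log t := neg_pos.mpr (Real.log_neg ht0 (by rw [ht]; linarith))
  refine Summable.of_nonneg_of_le (fun i ↦ by positivity) (fun i ↦ ?_) (h _ hlog)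
  rw [neg_neg, mul_comm, Real.exp_nat_mul, Real.exp_log ht0]
  exact pow_le_pow_left₀ hr0 (by rw [ht]; linarith) _

open Matrix in
theorem exists_thetaTriple (L : AddSubgroup (Fin 36 → ℝ))
    (hL : ∀ v, v ∈ L ↔ ∀ w ∈ L, ∃ m : ℤ, v ⬝ᵥ w = m) (hmin : ∀ x ∈ L, x ≠ 0 → 1 ≤ x ⬝ᵥ x) :
    ∃ (s : Fin 36 → ℝ) (ν μ : L → ℕ),
      (∀ x ∈ L, ∃ m : ℤ, 2 * (x ⬝ᵥ s) = x ⬝ᵥ x + 2 * m) ∧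
      (∀ x : L, (ν x : ℝ) = x.1 ⬝ᵥ x.1) ∧ (∀ x : L, (μ x : ℝ) = (x.1 + s) ⬝ᵥ (x.1 + s)) ∧
      (∀ x, Odd (μ x)) ∧
      (∀ r : ℝ, 0 ≤ r → r < 1 → Summable fun x ↦ r ^ ν x) ∧
      (∀ r : ℝ, 0 ≤ r → r < 1 → Summable fun x ↦ r ^ μ x) ∧
      ThetaTriple 18 (qSeries (fun _ ↦ 1) ν) (qSeries (fun x ↦ (-1) ^ ν x) ν)
        (qSeries (fun _ ↦ 1) μ) := by
  obtain ⟨s, hs⟩ := exists_characteristic_vector L hL hmin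
  have hdn : ∀ x : Fin 36 → ℝ, 0 ≤ x ⬝ᵥ x := fun x ↦
    Finset.sum_nonneg fun i _ ↦ mul_self_nonneg _
  have hν : ∀ x : L, ∃ n : ℕ, (n : ℝ) = x.1 ⬝ᵥ x.1 := fun x ↦ by
    obtain ⟨m, hm⟩ := (hL x).mp x.2 x x.2
    have hm0 : 0 ≤ m := by exact_mod_cast hm ▸ hdn x.1
    lift m to ℕ using hm0
    exact ⟨m, by simpa using hm.symm⟩
  choose ν hν using hν
  have hsν : ∀ r : ℝ, 0 ≤ r → r < 1 → Summable fun x ↦ r ^ ν x :=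
    summable_pow_of_summable_exp fun c hc ↦ by
      simpa [hν] using summable_exp_neg_selfDual L hL hmin hc 0
  set A := qSeries (fun _ ↦ 1) ν with hA
  set B := qSeries (fun x ↦ (-1) ^ ν x) ν with hB
  set C : ℂ → ℂ := fun z ↦ ∑' x : L, Complex.exp (Real.pi * Complex.I * z *
    (((x.1 + s) ⬝ᵥ (x.1 + s) : ℝ) : ℂ)) with hC
  have hAC : ∀ z : ℂ, A z = ∑' x : L, Complex.exp (Real.pi * Complex.I * z *
      ((x.1 ⬝ᵥ x.1 : ℝ) : ℂ)) := fun z ↦ tsum_congr fun x ↦ by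
    rw [one_mul, exp_pi_I_mul_pow, hν]
  have hBC : ∀ z : ℂ, B z = ∑' x : L, Complex.exp (Real.pi * Complex.I * z *
      ((x.1 ⬝ᵥ x.1 : ℝ) : ℂ)) * Complex.exp (2 * Real.pi * Complex.I * ((x.1 ⬝ᵥ s : ℝ) : ℂ)) :=
    fun z ↦ tsum_congr fun x ↦ by
      obtain ⟨m, hm⟩ := hs x x.2
      beta_reduce
      rw [exp_pi_I_mul_pow, ← exp_pi_I_mul_natCast, hν, mul_comm]
      congr 1
      rw [Complex.exp_eq_exp_iff_exists_int]
      refine ⟨-m, ?_⟩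
      have h1 : (2 : ℂ) * ((x.1 ⬝ᵥ s : ℝ) : ℂ) = ((x.1 ⬝ᵥ x.1 : ℝ) : ℂ) + 2 * m := by exact_mod_cast hm
      push_cast
      linear_combination (-(Real.pi : ℂ) * Complex.I) * h1
  have hA1 : ∀ z, A (z + 1) = B z := qSeries_one_add_one ν
  have hB1 : ∀ z, B (z + 1) = A z := qSeries_neg_one_add_one ν
  have hz0 : ∀ {z : ℂ}, 0 < z.im → z ≠ 0 := fun {z} h h' ↦ by simp [h'] at h
  have hAS : ∀ z : ℂ, 0 < z.im → A (-1 / z) = -z ^ 18 * A z := by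
    intro z hz
    have h := tsum_exp_selfDual L hL hmin 0 hz
    simp only [add_zero, dotProduct_zero, Complex.ofReal_zero, mul_zero, Complex.exp_zero, mul_one,
      ← hAC] at h
    rw [h]
    have := hz0 hz
    field_simp
  have hBS : ∀ z : ℂ, 0 < z.im → B (-1 / z) = -z ^ 18 * C z := by
    intro z hz
    have h := tsum_exp_selfDual L hL hmin s hz
    rw [← hBC] at h
    change C z = _ at h
    rw [h]
    have := hz0 hz
    field_simp
  have hCS : ∀ z : ℂ, 0 < z.im → C (-1 / z) = -z ^ 18 * B z := by
    intro z hz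
    have h := hBS (-1 / z) (im_neg_one_div_pos hz)
    have hz' := hz0 hz
    have h2 : -1 / (-1 / z) = z := by field_simp
    rw [h2] at h
    rw [h]
    field_simp
  have hC1 : ∀ z : ℂ, 0 < z.im → C (z + 1) = -C z := by
    intro z hz
    have hz1 : 0 < (z + 1).im := by simpa using hz
    have hu := im_neg_one_div_pos hz
    have e1 : z + 1 ≠ 0 := hz0 hz1
    have e2 : z ≠ 0 := hz0 hz
    set u := -1 / z - 1 with hu'
    have hui : 0 < u.im := by simpa [hu'] using hu
    have e3 : u ≠ 0 := hz0 hui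
    have e4 : u * z = -(z + 1) := by rw [hu']; field_simp; ring
    have h1 : A (-1 / (z + 1) + 1) = -(z + 1) ^ 18 * C (z + 1) := by
      rw [hA1, hBS _ hz1]
    have h2 : -1 / (z + 1) + 1 = -1 / u := by
      have e5 : u = -(z + 1) / z := by rw [← e4]; field_simp
      rw [e5]
      field_simp
      ring
    have h3 : A u = -z ^ 18 * C z := by
      rw [← hB1, hu', sub_add_cancel, hBS z hz]
    rw [h2, hAS u hui, h3] at h1
    have h4 : (z + 1) ^ 18 = u ^ 18 * z ^ 18 := by rw [← mul_pow, e4]; ring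
    have h5 : (z + 1) ^ 18 ≠ 0 := pow_ne_zero _ e1
    refine mul_left_cancel₀ h5 ?_
    rw [h4] at h1 ⊢
    linear_combination h1
  have hCI : C Complex.I ≠ 0 := by
    have h1 : C Complex.I = ((∑' x : L, Real.exp (-Real.pi * ((x.1 + s) ⬝ᵥ (x.1 + s))) : ℝ) : ℂ) := by
      rw [Complex.ofReal_tsum]
      refine tsum_congr fun x ↦ ?_
      rw [mul_assoc (Real.pi : ℂ), Complex.I_mul_I]
      push_cast
      congr 1
      ring
    rw [h1]
    exact_mod_cast ((summable_exp_neg_selfDual L hL hmin Real.pi_pos s).tsum_pos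
      (fun x ↦ (Real.exp_pos _).le) 0 (Real.exp_pos _)).ne'
  have hnorm : ∀ x : L, ∃ m : ℤ, (x.1 + s) ⬝ᵥ (x.1 + s) = s ⬝ᵥ s + 2 * m := fun x ↦ by
    obtain ⟨m, hm⟩ := hs x x.2
    refine ⟨ν x + m, ?_⟩
    simp only [add_dotProduct, dotProduct_add, dotProduct_comm s]
    push_cast
    rw [hν]
    linarith
  have hε : Complex.exp (Real.pi * Complex.I * ((s ⬝ᵥ s : ℝ) : ℂ)) = -1 := by
    have h1 : C (Complex.I + 1) = Complex.exp (Real.pi * Complex.I * ((s ⬝ᵥ s : ℝ) : ℂ)) *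
        C Complex.I := by
      simp only [hC]
      rw [← tsum_mul_left]
      refine tsum_congr fun x ↦ ?_
      obtain ⟨m, hm⟩ := hnorm x
      rw [← Complex.exp_add, Complex.exp_eq_exp_iff_exists_int]
      refine ⟨m, ?_⟩
      rw [hm]
      push_cast
      ring
    rw [hC1 _ (by simp)] at h1
    exact mul_right_cancel₀ hCI (by rw [← h1]; ring)
  have hodd : ∃ m : ℤ, s ⬝ᵥ s = 2 * m + 1 := by
    rw [← Complex.exp_pi_mul_I, Complex.exp_eq_exp_iff_exists_int] at hε
    obtain ⟨m, hm⟩ := hε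
    refine ⟨m, ?_⟩
    have h1 : (Real.pi * Complex.I : ℂ) ≠ 0 :=
      mul_ne_zero (by exact_mod_cast Real.pi_ne_zero) Complex.I_ne_zero
    have h2 : ((s ⬝ᵥ s : ℝ) : ℂ) = 2 * m + 1 :=
      mul_left_cancel₀ h1 (by rw [hm]; ring)
    exact_mod_cast h2
  obtain ⟨m₀, hm₀⟩ := hodd
  have hμ : ∀ x : L, ∃ n : ℕ, (n : ℝ) = (x.1 + s) ⬝ᵥ (x.1 + s) ∧ Odd n := fun x ↦ by
    obtain ⟨m, hm⟩ := hnorm x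
    have h0 := hdn (x.1 + s)
    have h1 : (x.1 + s) ⬝ᵥ (x.1 + s) = ((2 * (m₀ + m) + 1 : ℤ) : ℝ) := by
      rw [hm, hm₀]; push_cast; ring
    rw [h1] at h0
    have h2 : 0 ≤ 2 * (m₀ + m) + 1 := by exact_mod_cast h0
    refine ⟨(2 * (m₀ + m) + 1).toNat, ?_, ?_⟩
    · rw [h1]
      exact_mod_cast Int.toNat_of_nonneg h2
    · rw [Nat.odd_iff]
      omega
  choose μ hμ hμodd using hμ
  have hsμ : ∀ r : ℝ, 0 ≤ r → r < 1 → Summable fun x ↦ r ^ μ x :=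
    summable_pow_of_summable_exp fun c hc ↦ by
      simpa [hμ] using summable_exp_neg_selfDual L hL hmin hc s
  have hCq : qSeries (fun _ ↦ 1) μ = C := funext fun z ↦ tsum_congr fun x ↦ by
    rw [one_mul, exp_pi_I_mul_pow, hμ]
  refine ⟨s, ν, μ, hs, hν, hμ, hμodd, hsν, hsμ, ?_⟩
  have hCd := differentiableOn_qSeries (c := fun _ ↦ 1) (fun _ ↦ by simp) hsμ
  rw [hCq] at hCd ⊢
  exact ⟨differentiableOn_qSeries (fun _ ↦ by simp) hsν, differentiableOn_qSeries (fun _ ↦ by simp) hsν,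
    hCd, fun z _ ↦ hA1 z, fun z _ ↦ hB1 z, hC1, hAS, hBS, hCS⟩

lemma ThetaTriple.pow {k m : ℕ} (hm : Odd m) {A B C : ℂ → ℂ} (h : ThetaTriple k A B C) :
    ThetaTriple (k * m) (fun z ↦ A z ^ m) (fun z ↦ B z ^ m) (fun z ↦ C z ^ m) where
  differentiableOn_left := h.differentiableOn_left.pow m
  differentiableOn_mid := h.differentiableOn_mid.pow m
  differentiableOn_right := h.differentiableOn_right.pow m
  left_add_one z hz := by rw [h.left_add_one z hz]
  mid_add_one z hz := by rw [h.mid_add_one z hz]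
  right_add_one z hz := by rw [h.right_add_one z hz, hm.neg_pow]
  left_neg_inv z hz := by rw [h.left_neg_inv z hz, mul_pow, hm.neg_pow, pow_mul]
  mid_neg_inv z hz := by rw [h.mid_neg_inv z hz, mul_pow, hm.neg_pow, pow_mul]
  right_neg_inv z hz := by rw [h.right_neg_inv z hz, mul_pow, hm.neg_pow, pow_mul]

lemma cast_natAbs_sq {R : Type*} [Ring R] (n : ℤ) : ((n.natAbs ^ 2 : ℕ) : R) = (n : R) ^ 2 := by
  rw [Nat.cast_pow, ← Int.cast_natCast, Int.natCast_natAbs, ← Int.cast_pow, sq_abs, Int.cast_pow]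

lemma cast_toNat_sq_add_self (n : ℤ) : (((n ^ 2 + n).toNat : ℤ)) = n ^ 2 + n := by
  refine Int.toNat_of_nonneg ?_
  rcases le_or_gt 0 n with h | h <;> nlinarith

lemma summable_pow_natAbs_sq (r : ℝ) (hr0 : 0 ≤ r) (hr1 : r < 1) :
    Summable fun n : ℤ ↦ r ^ (n.natAbs ^ 2) :=
  summable_pow_of_summable_exp (fun c hc ↦ (summable_exp_neg_mul_int_sq hc).congr fun n ↦ by
    rw [cast_natAbs_sq]) r hr0 hr1

lemma summable_pow_sq_add_self (r : ℝ) (hr0 : 0 ≤ r) (hr1 : r < 1) :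
    Summable fun n : ℤ ↦ r ^ (n ^ 2 + n).toNat := by
  refine summable_pow_of_summable_exp (fun c hc ↦ ?_) r hr0 hr1
  refine Summable.of_nonneg_of_le (fun n ↦ (Real.exp_pos _).le) (fun n ↦ ?_)
    ((summable_exp_neg_mul_int_sq (half_pos hc)).mul_left (Real.exp (c / 2)))
  have : (((n ^ 2 + n).toNat : ℕ) : ℝ) = (n : ℝ) ^ 2 + n := by
    exact_mod_cast cast_toNat_sq_add_self n
  rw [this, ← Real.exp_add, Real.exp_le_exp]
  nlinarith [mul_nonneg hc.le (sq_nonneg (n + 1 : ℝ))]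

lemma jacobiTheta₂_zero_eq_qSeries (z : ℂ) :
    jacobiTheta₂ 0 z = qSeries (fun _ ↦ 1) (fun n : ℤ ↦ n.natAbs ^ 2) z := by
  refine tsum_congr fun n ↦ ?_
  rw [one_mul, jacobiTheta₂_term, ← Complex.exp_nat_mul, cast_natAbs_sq]
  congr 1
  ring

lemma jacobiTheta₂_half_eq_qSeries (z : ℂ) :
    jacobiTheta₂ (1 / 2) z =
      qSeries (fun n : ℤ ↦ (-1) ^ (n.natAbs ^ 2)) (fun n : ℤ ↦ n.natAbs ^ 2) z := by
  refine tsum_congr fun n ↦ ?_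
  have h2 : ((-1) ^ (n.natAbs ^ 2) : ℂ) = Complex.exp (n * (Real.pi * Complex.I)) := by
    rw [Complex.exp_int_mul, Complex.exp_pi_mul_I]
    rcases Int.even_or_odd n with h | h
    · rw [h.neg_one_zpow, (Int.natAbs_even.mpr h |>.pow_of_ne_zero two_ne_zero).neg_one_pow]
    · rw [h.neg_one_zpow, (Int.natAbs_odd.mpr h |>.pow).neg_one_pow]
  beta_reduce
  rw [h2, jacobiTheta₂_term, ← Complex.exp_nat_mul, cast_natAbs_sq, ← Complex.exp_add]
  congr 1
  ring

lemma jacobiTheta₂_neg_half_mul_eq_qSeries (z : ℂ) :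
    jacobiTheta₂ (-z / 2) z = qSeries (fun _ ↦ 1) (fun n : ℤ ↦ (n ^ 2 + n).toNat) z := by
  rw [qSeries, ← (Equiv.neg ℤ).tsum_eq]
  refine tsum_congr fun n ↦ ?_
  have : ((((-n) ^ 2 + (-n)).toNat : ℕ) : ℂ) = (-n : ℂ) ^ 2 + -n := by
    exact_mod_cast cast_toNat_sq_add_self (-n)
  rw [one_mul, jacobiTheta₂_term, ← Complex.exp_nat_mul, Equiv.neg_apply, this]
  congr 1
  ring

/-- The fourth power of Jacobi's `θ₃`, as a function of the half period ratio. -/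
noncomputable def thetaThree (z : ℂ) : ℂ := qSeries (fun _ ↦ 1) (fun n : ℤ ↦ n.natAbs ^ 2) z ^ 4

/-- The fourth power of Jacobi's `θ₄`. -/
noncomputable def thetaFour (z : ℂ) : ℂ :=
  qSeries (fun n : ℤ ↦ (-1) ^ (n.natAbs ^ 2)) (fun n : ℤ ↦ n.natAbs ^ 2) z ^ 4

/-- The fourth power of Jacobi's `θ₂`, divided by the nome. -/
noncomputable def thetaTwoDiv (z : ℂ) : ℂ :=
  qSeries (fun _ ↦ 1) (fun n : ℤ ↦ (n ^ 2 + n).toNat) z ^ 4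

lemma thetaFour_eq {z : ℂ} (hz : 0 < z.im) : thetaFour z = -(z ^ 2)⁻¹ *
    (Complex.exp (Real.pi * Complex.I * (-1 / z)) * thetaTwoDiv (-1 / z)) := by
  have hz0 : z ≠ 0 := fun h ↦ by simp [h] at hz
  rw [thetaFour, thetaTwoDiv, ← jacobiTheta₂_half_eq_qSeries, ← jacobiTheta₂_neg_half_mul_eq_qSeries,
    jacobiTheta₂_functional_equation]
  have h1 : (-(-1 / z) / 2) = 1 / 2 / z := by field_simp
  rw [h1, mul_pow, mul_pow, div_pow, one_pow, ← Complex.cpow_nat_mul, ← Complex.exp_nat_mul]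
  have h2 : (-Complex.I * z) ^ (((4 : ℕ) : ℂ) * (1 / 2)) = -z ^ 2 := by
    rw [show (((4 : ℕ) : ℂ) * (1 / 2)) = ((2 : ℕ) : ℂ) by norm_num, Complex.cpow_natCast, mul_pow]
    simp
  have h3 : ((4 : ℕ) : ℂ) * (-Real.pi * Complex.I * (1 / 2) ^ 2 / z) =
      Real.pi * Complex.I * (-1 / z) := by
    push_cast
    ring
  rw [h2, h3, mul_assoc]
  congr 1
  rw [one_div, inv_neg]

theorem thetaTriple_jacobi : ThetaTriple 2 thetaThree thetaFour
    (fun z ↦ Complex.exp (Real.pi * Complex.I * z) * thetaTwoDiv z) where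
  differentiableOn_left := (differentiableOn_qSeries (fun _ ↦ by simp) summable_pow_natAbs_sq).pow 4
  differentiableOn_mid := (differentiableOn_qSeries (fun _ ↦ by simp) summable_pow_natAbs_sq).pow 4
  differentiableOn_right := by
    refine DifferentiableOn.mul ?_
      ((differentiableOn_qSeries (fun _ ↦ by simp) summable_pow_sq_add_self).pow 4)
    fun_prop
  left_add_one z _ := by rw [thetaThree, qSeries_one_add_one, thetaFour]
  mid_add_one z _ := by rw [thetaFour, qSeries_neg_one_add_one, thetaThree]
  right_add_one z _ := by
    have h : thetaTwoDiv (z + 1) = thetaTwoDiv z := by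
      rw [thetaTwoDiv, qSeries_one_add_one, thetaTwoDiv]
      congr 2
      ext n
      refine Even.neg_one_pow ?_
      rw [← Int.even_coe_nat, cast_toNat_sq_add_self, sq, ← mul_add_one]
      exact Int.even_mul_succ_self n
    rw [h, mul_add, Complex.exp_add, mul_one, Complex.exp_pi_mul_I]
    ring
  left_neg_inv z hz := by
    have hz0 : z ≠ 0 := fun h ↦ by simp [h] at hz
    rw [thetaThree, thetaThree, ← jacobiTheta₂_zero_eq_qSeries, ← jacobiTheta₂_zero_eq_qSeries,
      jacobiTheta₂_functional_equation 0 z, mul_pow, mul_pow, div_pow, one_pow,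
      ← Complex.cpow_nat_mul]
    have h2 : (-Complex.I * z) ^ (((4 : ℕ) : ℂ) * (1 / 2)) = -z ^ 2 := by
      rw [show (((4 : ℕ) : ℂ) * (1 / 2)) = ((2 : ℕ) : ℂ) by norm_num, Complex.cpow_natCast, mul_pow]
      simp
    rw [h2]
    simp
    field_simp
  mid_neg_inv z hz := by
    have hz0 : z ≠ 0 := fun h ↦ by simp [h] at hz
    rw [thetaFour_eq (im_neg_one_div_pos hz)]
    have h2 : -1 / (-1 / z) = z := by field_simp
    rw [h2]
    field_simp
  right_neg_inv z hz := by
    have hz0 : z ≠ 0 := fun h ↦ by simp [h] at hz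
    rw [thetaFour_eq hz]
    field_simp

lemma ThetaTriple.smul_sub_smul {k : ℕ} {A B C A' B' C' : ℂ → ℂ} (h : ThetaTriple k A B C)
    (h' : ThetaTriple k A' B' C') (a b : ℂ) :
    ThetaTriple k (fun z ↦ a * A z - b * A' z) (fun z ↦ a * B z - b * B' z)
      (fun z ↦ a * C z - b * C' z) where
  differentiableOn_left :=
    (h.differentiableOn_left.const_mul a).sub (h'.differentiableOn_left.const_mul b)
  differentiableOn_mid :=
    (h.differentiableOn_mid.const_mul a).sub (h'.differentiableOn_mid.const_mul b)
  differentiableOn_right :=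
    (h.differentiableOn_right.const_mul a).sub (h'.differentiableOn_right.const_mul b)
  left_add_one z hz := by rw [h.left_add_one z hz, h'.left_add_one z hz]
  mid_add_one z hz := by rw [h.mid_add_one z hz, h'.mid_add_one z hz]
  right_add_one z hz := by rw [h.right_add_one z hz, h'.right_add_one z hz]; ring
  left_neg_inv z hz := by rw [h.left_neg_inv z hz, h'.left_neg_inv z hz]; ring
  mid_neg_inv z hz := by rw [h.mid_neg_inv z hz, h'.mid_neg_inv z hz]; ring
  right_neg_inv z hz := by rw [h.right_neg_inv z hz, h'.right_neg_inv z hz]; ring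

open UpperHalfPlane Asymptotics Filter in
lemma tendsto_exp_neg_mul_im_atImInfty {c : ℝ} (hc : 0 < c) :
    Tendsto (fun z : ℍ ↦ Real.exp (-c * z.im)) atImInfty (nhds 0) := by
  refine Real.tendsto_exp_atBot.comp ?_
  exact (tendsto_comap : Tendsto UpperHalfPlane.im atImInfty atTop).const_mul_atTop_of_neg
    (neg_neg_of_pos hc)

open UpperHalfPlane Asymptotics Filter in
lemma isBigO_exp_pi_I_mul : (fun z : ℍ ↦ Complex.exp (Real.pi * Complex.I * z)) =O[atImInfty]
    (1 : ℍ → ℝ) :=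
  IsBigO.of_bound 1 <| Eventually.of_forall fun z ↦ by
    simpa using (norm_exp_pi_I_mul_lt_one z.im_pos).le

open UpperHalfPlane Asymptotics Filter in
lemma eq_zero_of_add_exp_mul_eq_zero {e : ℂ} {r : ℍ → ℂ} (hr : r =O[atImInfty] (1 : ℍ → ℝ))
    (h : ∀ z : ℍ, e + Complex.exp (Real.pi * Complex.I * z) * r z = 0) : e = 0 := by
  have hq : (fun z : ℍ ↦ Complex.exp (Real.pi * Complex.I * z)) =o[atImInfty] (1 : ℍ → ℝ) := by
    refine (isLittleO_one_iff ℝ).mpr (tendsto_zero_iff_norm_tendsto_zero.mpr ?_)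
    exact (tendsto_exp_neg_mul_im_atImInfty Real.pi_pos).congr fun z ↦
      (norm_exp_pi_I_mul z).symm
  have h2 := (hq.mul_isBigO hr)
  simp only [Pi.one_apply, mul_one] at h2
  have h3 : Tendsto (fun z : ℍ ↦ Complex.exp (Real.pi * Complex.I * z) * r z) atImInfty (nhds 0) :=
    (isLittleO_one_iff ℝ).mp h2
  have h4 : Tendsto (fun _ : ℍ ↦ -e) atImInfty (nhds 0) :=
    h3.congr fun z ↦ by linear_combination h z
  simpa using tendsto_nhds_unique h4 tendsto_const_nhds

open UpperHalfPlane Asymptotics Filter in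
lemma eq_zero_of_weight_twelve_mul_add_two (m : ℕ) {f : ℂ → ℂ} {r : ℍ → ℂ}
    (hd : DifferentiableOn ℂ f {z : ℂ | 0 < z.im})
    (hT : ∀ z : ℂ, 0 < z.im → f (z + 1) = f z)
    (hS : ∀ z : ℂ, 0 < z.im → f (-1 / z) = z ^ (12 * m + 2) * f z)
    (hr : r =O[atImInfty] (1 : ℍ → ℝ))
    (hf : ∀ z : ℍ, f z = Complex.exp (Real.pi * Complex.I * z) ^ (2 * m) * r z) (z : ℍ) :
    f z = 0 := by
  have hO : (fun z : ℍ ↦ f z) =O[atImInfty] fun z : ℍ ↦ Real.exp (-2 * Real.pi * z.im) ^ m := by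
    have h1 : (fun z : ℍ ↦ Complex.exp (Real.pi * Complex.I * z) ^ (2 * m)) =O[atImInfty]
        fun z : ℍ ↦ Real.exp (-2 * Real.pi * z.im) ^ m := by
      refine IsBigO.of_bound 1 (Eventually.of_forall fun z ↦ ?_)
      rw [norm_pow, norm_exp_pi_I_mul, pow_mul, ← Real.exp_nat_mul, one_mul, norm_pow,
        Real.norm_of_nonneg (Real.exp_pos _).le]
      refine le_of_eq ?_
      congr 2
      push_cast
      rw [UpperHalfPlane.coe_im]
      ring
    simpa [funext hf] using h1.mul hr
  have ho : ∀ j < m, (fun z : ℍ ↦ f z) =o[atImInfty]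
      fun z : ℍ ↦ Real.exp (-2 * Real.pi * z.im) ^ j := fun j hj ↦ by
    refine hO.trans_isLittleO ?_
    obtain ⟨k, rfl⟩ := Nat.exists_eq_add_of_lt hj
    have h1 : (fun z : ℍ ↦ Real.exp (-2 * Real.pi * z.im) ^ (k + 1)) =o[atImInfty]
        (1 : ℍ → ℝ) := by
      refine (isLittleO_one_iff ℝ).mpr ?_
      have := (tendsto_exp_neg_mul_im_atImInfty Real.two_pi_pos).pow (k + 1)
      simpa using this
    simpa [pow_add, mul_assoc] using
      (isBigO_refl (fun z : ℍ ↦ Real.exp (-2 * Real.pi * z.im) ^ j) atImInfty).mul_isLittleO h1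
  have hb : (fun z : ℍ ↦ f z) =O[atImInfty] (1 : ℍ → ℝ) := by
    have h := (isBigO_exp_pi_I_mul.pow (2 * m)).mul hr
    exact h.congr (fun z ↦ (hf z).symm) fun z ↦ by simp
  obtain ⟨F, hF⟩ := exists_modularForm_levelOne (12 * m + 2) f hd hT hS hb
  have h0 := modularForm_levelOne_eq_zero m _ (by push_cast; rfl) F fun j hj ↦ by
    simpa [funext hF] using ho j hj
  rw [← hF, h0]
  rfl

section

variable {A B C : ℂ → ℂ}

/-- A combination of weight 26 and level one formed from a theta triple of weight 18. -/
noncomputable def ThetaTriple.weightTwentySix (A B C : ℂ → ℂ) (z : ℂ) : ℂ :=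
  Complex.exp (Real.pi * Complex.I * z) * thetaTwoDiv z * thetaThree z * thetaFour z *
    (A z * (Complex.exp (Real.pi * Complex.I * z) * thetaTwoDiv z - thetaFour z) +
      B z * (Complex.exp (Real.pi * Complex.I * z) * thetaTwoDiv z + thetaThree z) -
      C z * (thetaThree z + thetaFour z))

/-- A combination of weight 38 and level one formed from a theta triple of weight 18. -/
noncomputable def ThetaTriple.weightThirtyEight (A B C : ℂ → ℂ) (z : ℂ) : ℂ :=
  A z * thetaThree z * (Complex.exp (Real.pi * Complex.I * z) * thetaTwoDiv z) ^ 4 *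
      thetaFour z ^ 4 * (Complex.exp (Real.pi * Complex.I * z) * thetaTwoDiv z - thetaFour z) -
    B z * thetaFour z * (Complex.exp (Real.pi * Complex.I * z) * thetaTwoDiv z) ^ 4 *
      thetaThree z ^ 4 * (Complex.exp (Real.pi * Complex.I * z) * thetaTwoDiv z + thetaThree z) +
    C z * (Complex.exp (Real.pi * Complex.I * z) * thetaTwoDiv z) * thetaFour z ^ 4 *
      thetaThree z ^ 4 * (thetaThree z + thetaFour z)

open UpperHalfPlane Asymptotics Filter in
lemma ThetaTriple.eq_zero_of_weightTwentySix_eq (h : ThetaTriple 18 A B C) {r : ℍ → ℂ}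
    (hr : r =O[atImInfty] (1 : ℍ → ℝ))
    (hf : ∀ z : ℍ, weightTwentySix A B C z = Complex.exp (Real.pi * Complex.I * z) ^ 4 * r z)
    (z : ℍ) : r z = 0 := by
  have j := thetaTriple_jacobi
  suffices h0 : weightTwentySix A B C z = 0 from
    (mul_eq_zero.mp ((hf z).symm.trans h0)).resolve_left (pow_ne_zero _ (Complex.exp_ne_zero _))
  refine eq_zero_of_weight_twelve_mul_add_two 2 ?_ (fun z hz ↦ ?_) (fun z hz ↦ ?_) hr hf z
  · exact ((j.differentiableOn_right.mul j.differentiableOn_left).mul j.differentiableOn_mid).mul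
      (((h.differentiableOn_left.mul (j.differentiableOn_right.sub j.differentiableOn_mid)).add
        (h.differentiableOn_mid.mul (j.differentiableOn_right.add j.differentiableOn_left))).sub
        (h.differentiableOn_right.mul (j.differentiableOn_left.add j.differentiableOn_mid)))
  · have j3 := j.right_add_one z hz
    simp only [weightTwentySix, h.left_add_one z hz, h.mid_add_one z hz, h.right_add_one z hz,
      j.left_add_one z hz, j.mid_add_one z hz]
    simp only [j3]
    ring
  · have j3 := j.right_neg_inv z hz
    simp only [weightTwentySix, h.left_neg_inv z hz, h.mid_neg_inv z hz, h.right_neg_inv z hz,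
      j.left_neg_inv z hz, j.mid_neg_inv z hz]
    simp only [j3]
    ring

open UpperHalfPlane Asymptotics Filter in
lemma ThetaTriple.eq_zero_of_weightThirtyEight_eq (h : ThetaTriple 18 A B C) {r : ℍ → ℂ}
    (hr : r =O[atImInfty] (1 : ℍ → ℝ))
    (hf : ∀ z : ℍ, weightThirtyEight A B C z = Complex.exp (Real.pi * Complex.I * z) ^ 6 * r z)
    (z : ℍ) : r z = 0 := by
  have j := thetaTriple_jacobi
  suffices h0 : weightThirtyEight A B C z = 0 from
    (mul_eq_zero.mp ((hf z).symm.trans h0)).resolve_left (pow_ne_zero _ (Complex.exp_ne_zero _))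
  refine eq_zero_of_weight_twelve_mul_add_two 3 ?_ (fun z hz ↦ ?_) (fun z hz ↦ ?_) hr hf z
  · exact (((((h.differentiableOn_left.mul j.differentiableOn_left).mul
      (j.differentiableOn_right.pow 4)).mul (j.differentiableOn_mid.pow 4)).mul
      (j.differentiableOn_right.sub j.differentiableOn_mid)).sub
      ((((h.differentiableOn_mid.mul j.differentiableOn_mid).mul
      (j.differentiableOn_right.pow 4)).mul (j.differentiableOn_left.pow 4)).mul
      (j.differentiableOn_right.add j.differentiableOn_left))).add
      ((((h.differentiableOn_right.mul j.differentiableOn_right).mul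
      (j.differentiableOn_mid.pow 4)).mul (j.differentiableOn_left.pow 4)).mul
      (j.differentiableOn_left.add j.differentiableOn_mid))
  · have j3 := j.right_add_one z hz
    simp only [weightThirtyEight, h.left_add_one z hz, h.mid_add_one z hz, h.right_add_one z hz,
      j.left_add_one z hz, j.mid_add_one z hz]
    simp only [j3]
    ring
  · have j3 := j.right_neg_inv z hz
    simp only [weightThirtyEight, h.left_neg_inv z hz, h.mid_neg_inv z hz, h.right_neg_inv z hz,
      j.left_neg_inv z hz, j.mid_neg_inv z hz]
    simp only [j3]
    ring

end

section Truncation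

variable {R : Type*} [CommRing R]

lemma weightTwentySix_aux {q t2 t3 t4 a b c n s t : R} (hq : q ^ 4 = 0)
    (h2 : t2 = 2 + 2 * q ^ 2) (h3 : t3 = 1 + 2 * q) (h4 : t4 = 1 - 2 * q)
    (ha : a = 1 + n * q ^ 3) (hb : b = 1 - n * q ^ 3) (hc : c = s * q + t * q ^ 3) :
    t2 ^ 4 * t3 ^ 4 * t4 ^ 4 *
      ((48 * a - (s - 24) * (t3 ^ 4) ^ 9) * (q * t2 ^ 4 - t4 ^ 4) +
        (48 * b - (s - 24) * (t4 ^ 4) ^ 9) * (q * t2 ^ 4 + t3 ^ 4) -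
        (48 * c - (s - 24) * (q * t2 ^ 4) ^ 9) * (t3 ^ 4 + t4 ^ 4)) =
      1536 * (960 - n - t - 60 * s) * q ^ 3 := by
  have x3 : t3 ^ 4 = 1 + 8 * q + 24 * q ^ 2 + 32 * q ^ 3 := by
    rw [h3]; linear_combination 16 * hq
  have x4 : t4 ^ 4 = 1 - 8 * q + 24 * q ^ 2 - 32 * q ^ 3 := by
    rw [h4]; linear_combination 16 * hq
  have y : t2 ^ 4 = 16 + 64 * q ^ 2 := by
    rw [h2]; linear_combination (96 + 64 * q ^ 2 + 16 * q ^ 4) * hq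
  have x39 : (t3 ^ 4) ^ 9 = 1 + 72 * q + 2520 * q ^ 2 + 57120 * q ^ 3 := by
    have : (t3 ^ 4) ^ 3 = 1 + 24 * q + 264 * q ^ 2 + 1760 * q ^ 3 := by
      rw [x3]; grobner
    rw [show 9 = 3 * 3 from rfl, pow_mul, this]; grobner
  have x49 : (t4 ^ 4) ^ 9 = 1 - 72 * q + 2520 * q ^ 2 - 57120 * q ^ 3 := by
    have : (t4 ^ 4) ^ 3 = 1 - 24 * q + 264 * q ^ 2 - 1760 * q ^ 3 := by
      rw [x4]; grobner
    rw [show 9 = 3 * 3 from rfl, pow_mul, this]; grobner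
  have y9 : (q * t2 ^ 4) ^ 9 = 0 := by
    rw [mul_pow]; linear_combination q ^ 5 * (t2 ^ 4) ^ 9 * hq
  rw [x39, x49, y9, x3, x4, y, ha, hb, hc]
  clear * - hq
  grobner

lemma weightThirtyEight_aux {q t2 t3 t4 a b c : R} (hq : q ^ 3 = 0)
    (h2 : t2 = 2 + 2 * q ^ 2) (h3 : t3 = 1 + 2 * q) (h4 : t4 = 1 - 2 * q)
    (ha : a = 1) (hb : b = 1) :
    (a - (t3 ^ 4) ^ 9) * t3 ^ 4 * (t2 ^ 4) ^ 4 * (t4 ^ 4) ^ 4 * (q * t2 ^ 4 - t4 ^ 4) -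
      (b - (t4 ^ 4) ^ 9) * t4 ^ 4 * (t2 ^ 4) ^ 4 * (t3 ^ 4) ^ 4 * (q * t2 ^ 4 + t3 ^ 4) +
      q ^ 4 * c = -122683392 * q ^ 2 := by
  have x3 : t3 ^ 4 = 1 + 8 * q + 24 * q ^ 2 := by rw [h3]; grobner
  have x4 : t4 ^ 4 = 1 - 8 * q + 24 * q ^ 2 := by rw [h4]; grobner
  have y : t2 ^ 4 = 16 + 64 * q ^ 2 := by rw [h2]; grobner
  have x39 : (t3 ^ 4) ^ 9 = 1 + 72 * q + 2520 * q ^ 2 := by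
    have : (t3 ^ 4) ^ 3 = 1 + 24 * q + 264 * q ^ 2 := by rw [x3]; grobner
    rw [show 9 = 3 * 3 from rfl, pow_mul, this]; grobner
  have x49 : (t4 ^ 4) ^ 9 = 1 - 72 * q + 2520 * q ^ 2 := by
    have : (t4 ^ 4) ^ 3 = 1 - 24 * q + 264 * q ^ 2 := by rw [x4]; grobner
    rw [show 9 = 3 * 3 from rfl, pow_mul, this]; grobner
  have x34 : (t3 ^ 4) ^ 4 = 1 + 32 * q + 480 * q ^ 2 := by rw [x3]; grobner
  have x44 : (t4 ^ 4) ^ 4 = 1 - 32 * q + 480 * q ^ 2 := by rw [x4]; grobner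
  have y4 : (t2 ^ 4) ^ 4 = 65536 + 1048576 * q ^ 2 := by rw [y]; grobner
  rw [x39, x49, x34, x44, y4, x3, x4, y, ha, hb]
  clear * - hq
  grobner

lemma dvd_sub_iff_mk_eq {d x y : R} :
    d ∣ x - y ↔ Ideal.Quotient.mk (Ideal.span {d}) x = Ideal.Quotient.mk (Ideal.span {d}) y := by
  rw [Ideal.Quotient.eq, Ideal.mem_span_singleton]

lemma mk_span_singleton_pow_eq_zero (q : R) (n : ℕ) :
    Ideal.Quotient.mk (Ideal.span {q ^ n}) q ^ n = 0 := by
  rw [← map_pow, Ideal.Quotient.eq_zero_iff_mem]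
  exact Ideal.mem_span_singleton_self _

lemma weightTwentySix_dvd {q t2 t3 t4 a b c : R} {n s t : ℤ}
    (h2 : q ^ 4 ∣ t2 - (2 + 2 * q ^ 2)) (h3 : q ^ 4 ∣ t3 - (1 + 2 * q))
    (h4 : q ^ 4 ∣ t4 - (1 - 2 * q)) (ha : q ^ 4 ∣ a - (1 + n * q ^ 3))
    (hb : q ^ 4 ∣ b - (1 - n * q ^ 3)) (hc : q ^ 4 ∣ c - (s * q + t * q ^ 3)) :
    q ^ 4 ∣ t2 ^ 4 * t3 ^ 4 * t4 ^ 4 *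
      ((48 * a - (s - 24) * (t3 ^ 4) ^ 9) * (q * t2 ^ 4 - t4 ^ 4) +
        (48 * b - (s - 24) * (t4 ^ 4) ^ 9) * (q * t2 ^ 4 + t3 ^ 4) -
        (48 * c - (s - 24) * (q * t2 ^ 4) ^ 9) * (t3 ^ 4 + t4 ^ 4)) -
      1536 * (960 - n - t - 60 * s) * q ^ 3 := by
  rw [dvd_sub_iff_mk_eq] at *
  simp only [map_add, map_sub, map_mul, map_pow, map_ofNat, map_one, map_intCast] at *
  exact weightTwentySix_aux (mk_span_singleton_pow_eq_zero q 4) h2 h3 h4 ha hb hc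

lemma weightThirtyEight_dvd {q t2 t3 t4 a b c : R}
    (h2 : q ^ 3 ∣ t2 - (2 + 2 * q ^ 2)) (h3 : q ^ 3 ∣ t3 - (1 + 2 * q))
    (h4 : q ^ 3 ∣ t4 - (1 - 2 * q)) (ha : q ^ 3 ∣ a - 1) (hb : q ^ 3 ∣ b - 1) :
    q ^ 3 ∣ (a - (t3 ^ 4) ^ 9) * t3 ^ 4 * (t2 ^ 4) ^ 4 * (t4 ^ 4) ^ 4 * (q * t2 ^ 4 - t4 ^ 4) -
      (b - (t4 ^ 4) ^ 9) * t4 ^ 4 * (t2 ^ 4) ^ 4 * (t3 ^ 4) ^ 4 * (q * t2 ^ 4 + t3 ^ 4) +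
      q ^ 4 * c - -122683392 * q ^ 2 := by
  rw [dvd_sub_iff_mk_eq] at *
  simp only [map_add, map_sub, map_mul, map_pow, map_ofNat, map_one, map_neg] at *
  exact weightThirtyEight_aux (mk_span_singleton_pow_eq_zero q 3) h2 h3 h4 ha hb

end Truncation

section

open UpperHalfPlane Asymptotics Filter

/-- The ring of functions on the upper half plane which are bounded at `i∞`. -/
noncomputable abbrev boundedAtInftyRing : Subalgebra ℂ (ℍ → ℂ) :=
  boundedFilterSubalgebra ℂ atImInfty

/-- The local parameter `exp (π i z)` as a function bounded at `i∞`. -/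
noncomputable def nome : boundedAtInftyRing :=
  ⟨fun z ↦ Complex.exp (Real.pi * Complex.I * z), isBigO_exp_pi_I_mul⟩

lemma nome_apply (z : ℍ) : nome.1 z = Complex.exp (Real.pi * Complex.I * z) := rfl

lemma exists_nome_pow_dvd_sub_sum {ι : Type*} {c : ι → ℂ} {ν : ι → ℕ} {g : ℕ → ℤ}
    (hg : ∀ i, c i = g (ν i)) (hg1 : ∀ j, |g j| ≤ 1)
    (hs : ∀ r : ℝ, 0 ≤ r → r < 1 → Summable fun i ↦ r ^ ν i) (n : ℕ) :
    ∃ a : boundedAtInftyRing, (∀ z : ℍ, a.1 z = qSeries c ν z) ∧ nome ^ n ∣ a -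
      ∑ j ∈ Finset.range n, ((g j * {i | ν i = j}.ncard : ℤ) : boundedAtInftyRing) * nome ^ j := by
  have hfin := finite_exponent_lt hs n
  have hT : ∀ i, i ∈ hfin.toFinset ↔ ν i < n := fun i ↦ by simp
  have hc : ∀ i, ‖c i‖ ≤ 1 := fun i ↦ by
    rw [hg, Complex.norm_intCast]
    exact_mod_cast hg1 _
  obtain ⟨r, hr, hrz⟩ := exists_qSeries_eq_sum_add hc hs n _ hT
  set P : boundedAtInftyRing :=
    ∑ j ∈ Finset.range n, ((g j * {i | ν i = j}.ncard : ℤ) : boundedAtInftyRing) * nome ^ j with hP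
  have hPz : ∀ z : ℍ, P.1 z =
      ∑ i ∈ hfin.toFinset, c i * Complex.exp (Real.pi * Complex.I * z) ^ ν i := fun z ↦ by
    have h1 : P.1 z = ∑ j ∈ Finset.range n, ((g j * {i | ν i = j}.ncard : ℤ) : ℂ) *
        Complex.exp (Real.pi * Complex.I * z) ^ j := by
      rw [hP, AddSubmonoidClass.coe_finsetSum, Finset.sum_apply]
      rfl
    rw [h1, ← Finset.sum_fiberwise_of_maps_to (t := Finset.range n) (g := ν)
      fun i hi ↦ Finset.mem_range.mpr ((hT i).mp hi)]
    refine Finset.sum_congr rfl fun j hj ↦ ?_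
    have hcard : {i | ν i = j}.ncard = (hfin.toFinset.filter fun i ↦ ν i = j).card := by
      rw [← Set.ncard_coe_finset]
      congr 1
      ext i
      have := Finset.mem_range.mp hj
      simp only [Set.mem_ofPred_eq, Finset.coe_filter, hT]
      omega
    rw [Finset.sum_congr rfl fun i hi ↦ by rw [hg i, (Finset.mem_filter.mp hi).2],
      Finset.sum_const, hcard, nsmul_eq_mul]
    push_cast
    ring
  refine ⟨P + nome ^ n * ⟨r, hr⟩, fun z ↦ ?_, ⟨r, hr⟩, by ring⟩
  rw [hrz, ← hPz]
  rfl

lemma exists_nome_pow_dvd_sub_sum_one {ι : Type*} {ν : ι → ℕ}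
    (hs : ∀ r : ℝ, 0 ≤ r → r < 1 → Summable fun i ↦ r ^ ν i) (n : ℕ) :
    ∃ a : boundedAtInftyRing, (∀ z : ℍ, a.1 z = qSeries (fun _ ↦ 1) ν z) ∧ nome ^ n ∣ a -
      ∑ j ∈ Finset.range n, (({i | ν i = j}.ncard : ℤ) : boundedAtInftyRing) * nome ^ j := by
  simpa using exists_nome_pow_dvd_sub_sum (c := fun _ ↦ 1) (g := fun _ ↦ 1) (by simp) (by simp) hs n

lemma exists_nome_pow_dvd_sub_sum_neg_one {ι : Type*} {ν : ι → ℕ}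
    (hs : ∀ r : ℝ, 0 ≤ r → r < 1 → Summable fun i ↦ r ^ ν i) (n : ℕ) :
    ∃ a : boundedAtInftyRing, (∀ z : ℍ, a.1 z = qSeries (fun i ↦ (-1) ^ ν i) ν z) ∧ nome ^ n ∣ a -
      ∑ j ∈ Finset.range n,
        (((-1) ^ j * {i | ν i = j}.ncard : ℤ) : boundedAtInftyRing) * nome ^ j :=
  exists_nome_pow_dvd_sub_sum (by simp) (by simp [abs_pow]) hs n

lemma ncard_natAbs_sq_eq_zero : {m : ℤ | m.natAbs ^ 2 = 0}.ncard = 1 := by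
  rw [Set.ncard_eq_one]
  exact ⟨0, by ext; simp⟩

lemma ncard_natAbs_sq_eq_one : {m : ℤ | m.natAbs ^ 2 = 1}.ncard = 2 := by
  rw [Set.ncard_eq_two]
  refine ⟨1, -1, by decide, ?_⟩
  ext m
  simp only [Set.mem_ofPred_eq, Set.mem_insert_iff, Set.mem_singleton_iff]
  rw [Nat.pow_eq_one]
  omega

lemma ncard_natAbs_sq_eq_of_lt {j : ℕ} (h1 : 1 < j) (h4 : j < 4) :
    {m : ℤ | m.natAbs ^ 2 = j}.ncard = 0 := by
  convert Set.ncard_empty ℤ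
  ext m
  simp only [Set.mem_ofPred_eq, Set.mem_empty_iff_false, iff_false]
  intro h
  have : m.natAbs < 2 := by nlinarith
  interval_cases m.natAbs <;> omega

lemma sq_add_self_toNat_eq {m : ℤ} {j : ℕ} : (m ^ 2 + m).toNat = j ↔ m ^ 2 + m = j := by
  rw [← cast_toNat_sq_add_self]
  exact Nat.cast_inj.symm

lemma ncard_sq_add_self_eq_zero : {m : ℤ | (m ^ 2 + m).toNat = 0}.ncard = 2 := by
  rw [Set.ncard_eq_two]
  refine ⟨0, -1, by decide, ?_⟩
  ext m
  simp only [Set.mem_ofPred_eq, Set.mem_insert_iff, Set.mem_singleton_iff, sq_add_self_toNat_eq]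
  constructor
  · intro h
    have : m * (m + 1) = 0 := by push_cast at h; linarith
    rcases mul_eq_zero.mp this with h | h <;> omega
  · rintro (rfl | rfl) <;> norm_num

lemma ncard_sq_add_self_eq_two : {m : ℤ | (m ^ 2 + m).toNat = 2}.ncard = 2 := by
  rw [Set.ncard_eq_two]
  refine ⟨1, -2, by decide, ?_⟩
  ext m
  simp only [Set.mem_ofPred_eq, Set.mem_insert_iff, Set.mem_singleton_iff, sq_add_self_toNat_eq]
  constructor
  · intro h
    have : (m - 1) * (m + 2) = 0 := by push_cast at h; linarith
    rcases mul_eq_zero.mp this with h | h <;> omega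
  · rintro (rfl | rfl) <;> norm_num

lemma ncard_sq_add_self_eq_of_odd {j : ℕ} (hj : Odd j) :
    {m : ℤ | (m ^ 2 + m).toNat = j}.ncard = 0 := by
  convert Set.ncard_empty ℤ
  ext m
  simp only [Set.mem_ofPred_eq, Set.mem_empty_iff_false, iff_false, sq_add_self_toNat_eq]
  intro h
  have h2 := Int.even_mul_succ_self m
  rw [mul_add_one, ← sq, h, Int.even_coe_nat] at h2
  exact Nat.not_even_iff_odd.mpr hj h2

/-- The nome expansions of the fourth roots of the three theta functions. -/
lemma exists_nome_expansion_jacobi : ∃ t2 t3 t4 : boundedAtInftyRing,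
    (∀ z : ℍ, thetaTwoDiv z = t2.1 z ^ 4) ∧ (∀ z : ℍ, thetaThree z = t3.1 z ^ 4) ∧
    (∀ z : ℍ, thetaFour z = t4.1 z ^ 4) ∧ nome ^ 4 ∣ t2 - (2 + 2 * nome ^ 2) ∧
    nome ^ 4 ∣ t3 - (1 + 2 * nome) ∧ nome ^ 4 ∣ t4 - (1 - 2 * nome) := by
  obtain ⟨t2, h2, d2⟩ := exists_nome_pow_dvd_sub_sum_one summable_pow_sq_add_self 4
  obtain ⟨t3, h3, d3⟩ := exists_nome_pow_dvd_sub_sum_one summable_pow_natAbs_sq 4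
  obtain ⟨t4, h4, d4⟩ := exists_nome_pow_dvd_sub_sum_neg_one summable_pow_natAbs_sq 4
  refine ⟨t2, t3, t4, fun z ↦ by rw [h2, thetaTwoDiv], fun z ↦ by rw [h3, thetaThree],
    fun z ↦ by rw [h4, thetaFour], ?_, ?_, ?_⟩
  · simpa [Finset.sum_range_succ, -Int.toNat_eq_zero, ncard_sq_add_self_eq_zero, ncard_sq_add_self_eq_two,
      ncard_sq_add_self_eq_of_odd (by decide : Odd 1),
      ncard_sq_add_self_eq_of_odd (by decide : Odd 3)] using d2
  · rw [Finset.sum_range_succ, Finset.sum_range_succ, Finset.sum_range_succ, Finset.sum_range_one,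
      ncard_natAbs_sq_eq_zero, ncard_natAbs_sq_eq_one,
      ncard_natAbs_sq_eq_of_lt (by decide) (by decide),
      ncard_natAbs_sq_eq_of_lt (by decide) (by decide)] at d3
    simpa using d3
  · rw [Finset.sum_range_succ, Finset.sum_range_succ, Finset.sum_range_succ, Finset.sum_range_one,
      ncard_natAbs_sq_eq_zero, ncard_natAbs_sq_eq_one,
      ncard_natAbs_sq_eq_of_lt (by decide) (by decide),
      ncard_natAbs_sq_eq_of_lt (by decide) (by decide)] at d4
    refine d4.trans (dvd_of_eq ?_)
    push_cast
    ring

end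

section

open UpperHalfPlane Asymptotics Filter

variable {ι κ : Type*} {ν : ι → ℕ} {μ : κ → ℕ}

/-- The linear relation between the first coefficients of the theta series of a lattice of
dimension 36 and minimum at least 3, and those of its shadow. -/
lemma ThetaTriple.ncard_add_ncard_add_eq
    (hν : ∀ r : ℝ, 0 ≤ r → r < 1 → Summable fun i ↦ r ^ ν i)
    (hμ : ∀ r : ℝ, 0 ≤ r → r < 1 → Summable fun i ↦ r ^ μ i)
    (h : ThetaTriple 18 (qSeries (fun _ ↦ 1) ν) (qSeries (fun x ↦ (-1) ^ ν x) ν)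
      (qSeries (fun _ ↦ 1) μ))
    (h0 : {i | ν i = 0}.ncard = 1) (h1 : {i | ν i = 1}.ncard = 0) (h2 : {i | ν i = 2}.ncard = 0)
    (k0 : {i | μ i = 0}.ncard = 0) (k2 : {i | μ i = 2}.ncard = 0) :
    {i | ν i = 3}.ncard + {i | μ i = 3}.ncard + 60 * {i | μ i = 1}.ncard = 960 := by
  obtain ⟨t2, t3, t4, e2, e3, e4, d2, d3, d4⟩ := exists_nome_expansion_jacobi
  obtain ⟨a, ea, da⟩ := exists_nome_pow_dvd_sub_sum_one hν 4
  obtain ⟨b, eb, db⟩ := exists_nome_pow_dvd_sub_sum_neg_one hν 4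
  obtain ⟨c, ec, dc⟩ := exists_nome_pow_dvd_sub_sum_one hμ 4
  set n := {i | ν i = 3}.ncard
  set s := {i | μ i = 1}.ncard
  set t := {i | μ i = 3}.ncard
  replace da : nome ^ 4 ∣ a - (1 + (n : ℤ) * nome ^ 3) := da.trans <| dvd_of_eq <| by
    simp [Finset.sum_range_succ, h0, h1, h2, n]
  replace db : nome ^ 4 ∣ b - (1 - (n : ℤ) * nome ^ 3) := db.trans <| dvd_of_eq <| by
    simp only [Finset.sum_range_succ, Finset.sum_range_zero, h0, h1, h2]
    push_cast
    ring
  replace dc : nome ^ 4 ∣ c - ((s : ℤ) * nome + (t : ℤ) * nome ^ 3) := dc.trans <| dvd_of_eq <| by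
    simp [Finset.sum_range_succ, k0, k2, s, t]
  obtain ⟨r, hr⟩ := weightTwentySix_dvd d2 d3 d4 da db dc
  have hD := h.smul_sub_smul (thetaTriple_jacobi.pow (m := 9) (by decide)) 48 (s - 24)
  set e : ℂ := 1536 * (960 - n - t - 60 * s) with he
  have hb : (fun z : ℍ ↦ e + Complex.exp (Real.pi * Complex.I * z) * r.1 z) =O[atImInfty]
      (1 : ℍ → ℝ) := (algebraMap ℂ boundedAtInftyRing e + nome * r).2
  have he0 : e = 0 := by
    refine eq_zero_of_add_exp_mul_eq_zero r.2 (hD.eq_zero_of_weightTwentySix_eq hb fun z ↦ ?_)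
    have hz := congrArg (fun f : boundedAtInftyRing ↦ f.1 z) hr
    have hz' : t2.1 z ^ 4 * t3.1 z ^ 4 * t4.1 z ^ 4 *
        ((48 * a.1 z - (s - 24) * (t3.1 z ^ 4) ^ 9) * (nome.1 z * t2.1 z ^ 4 - t4.1 z ^ 4) +
        (48 * b.1 z - (s - 24) * (t4.1 z ^ 4) ^ 9) * (nome.1 z * t2.1 z ^ 4 + t3.1 z ^ 4) -
        (48 * c.1 z - (s - 24) * (nome.1 z * t2.1 z ^ 4) ^ 9) * (t3.1 z ^ 4 + t4.1 z ^ 4)) -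
        1536 * (960 - n - t - 60 * s) * nome.1 z ^ 3 = nome.1 z ^ 4 * r.1 z := hz
    rw [ea, eb, ec, ← e2, ← e3, ← e4, nome_apply] at hz'
    rw [weightTwentySix]
    linear_combination Complex.exp (Real.pi * Complex.I * z) * hz'
  have : ((n + t + 60 * s : ℕ) : ℂ) = (960 : ℕ) := by
    push_cast
    linear_combination he0 / (-1536)
  exact_mod_cast this

/-- No shadow of a lattice of dimension 36 and minimum at least 3 has minimum at least 7. -/
lemma ThetaTriple.exists_lt_seven
    (hν : ∀ r : ℝ, 0 ≤ r → r < 1 → Summable fun i ↦ r ^ ν i)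
    (hμ : ∀ r : ℝ, 0 ≤ r → r < 1 → Summable fun i ↦ r ^ μ i)
    (h : ThetaTriple 18 (qSeries (fun _ ↦ 1) ν) (qSeries (fun x ↦ (-1) ^ ν x) ν)
      (qSeries (fun _ ↦ 1) μ))
    (h0 : {i | ν i = 0}.ncard = 1) (h1 : {i | ν i = 1}.ncard = 0) (h2 : {i | ν i = 2}.ncard = 0) :
    ∃ i, μ i < 7 := by
  by_contra! hμ7
  obtain ⟨t2, t3, t4, e2, e3, e4, d2, d3, d4⟩ := exists_nome_expansion_jacobi
  obtain ⟨a, ea, da⟩ := exists_nome_pow_dvd_sub_sum_one hν 3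
  obtain ⟨b, eb, db⟩ := exists_nome_pow_dvd_sub_sum_neg_one hν 3
  obtain ⟨c, ec, dc⟩ := exists_nome_pow_dvd_sub_sum_one hμ 7
  replace da : nome ^ 3 ∣ a - 1 := da.trans <| dvd_of_eq <| by
    simp [Finset.sum_range_succ, h0, h1, h2]
  replace db : nome ^ 3 ∣ b - 1 := db.trans <| dvd_of_eq <| by
    simp [Finset.sum_range_succ, h0, h1, h2]
  obtain ⟨c', rfl⟩ : nome ^ 7 ∣ c := by
    rw [Finset.sum_eq_zero, sub_zero] at dc
    · exact dc
    · intro j hj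
      have : {i | μ i = j} = ∅ := by
        ext i
        have := hμ7 i
        have := Finset.mem_range.mp hj
        simp only [Set.mem_ofPred_eq, Set.mem_empty_iff_false, iff_false]
        omega
      simp [this]
  have hd : (nome ^ 3 : boundedAtInftyRing) ∣ nome ^ 4 := pow_dvd_pow _ (by decide)
  obtain ⟨r, hr⟩ := weightThirtyEight_dvd
    (c := (c' - nome ^ 2 * (t2 ^ 4) ^ 9) * t2 ^ 4 * (t4 ^ 4) ^ 4 * (t3 ^ 4) ^ 4 * (t3 ^ 4 + t4 ^ 4))
    (hd.trans d2) (hd.trans d3) (hd.trans d4) da db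
  have hD := h.smul_sub_smul (thetaTriple_jacobi.pow (m := 9) (by decide)) 1 1
  have hb : (fun z : ℍ ↦ -122683392 + Complex.exp (Real.pi * Complex.I * z) * r.1 z) =O[atImInfty]
      (1 : ℍ → ℝ) := (algebraMap ℂ boundedAtInftyRing (-122683392) + nome * r).2
  have he0 : (-122683392 : ℂ) = 0 := by
    refine eq_zero_of_add_exp_mul_eq_zero r.2 (hD.eq_zero_of_weightThirtyEight_eq hb fun z ↦ ?_)
    have hz := congrArg (fun f : boundedAtInftyRing ↦ f.1 z) hr
    have hz' : (a.1 z - (t3.1 z ^ 4) ^ 9) * t3.1 z ^ 4 * (t2.1 z ^ 4) ^ 4 * (t4.1 z ^ 4) ^ 4 *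
        (nome.1 z * t2.1 z ^ 4 - t4.1 z ^ 4) -
        (b.1 z - (t4.1 z ^ 4) ^ 9) * t4.1 z ^ 4 * (t2.1 z ^ 4) ^ 4 * (t3.1 z ^ 4) ^ 4 *
        (nome.1 z * t2.1 z ^ 4 + t3.1 z ^ 4) +
        nome.1 z ^ 4 * ((c'.1 z - nome.1 z ^ 2 * (t2.1 z ^ 4) ^ 9) * t2.1 z ^ 4 *
        (t4.1 z ^ 4) ^ 4 * (t3.1 z ^ 4) ^ 4 * (t3.1 z ^ 4 + t4.1 z ^ 4)) -
        -122683392 * nome.1 z ^ 2 = nome.1 z ^ 3 * r.1 z := hz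
    have ec' : nome.1 z ^ 7 * c'.1 z = qSeries (fun _ ↦ 1) μ z := ec z
    rw [ea, eb, ← e2, ← e3, ← e4, nome_apply] at hz'
    rw [weightThirtyEight, ← ec', nome_apply]
    linear_combination Complex.exp (Real.pi * Complex.I * z) ^ 4 * hz'
  norm_num at he0

end

theorem stmt13 (L : AddSubgroup (Fin 36 → ℝ))
    (huni : (L : Set (Fin 36 → ℝ)) = dualLattice (L : Set (Fin 36 → ℝ)))
    (hodd : ∃ x ∈ L, ¬ ∃ m : ℤ, ∑ i, x i * x i = ((2 * m : ℤ) : ℝ))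
    (hmin : ∀ x ∈ L, x ≠ 0 → (3 : ℝ) ≤ ∑ i, x i * x i)
    (hex : ∃ x ∈ L, ∑ i, x i * x i = (3 : ℝ)) :
    {x : Fin 36 → ℝ | x ∈ L ∧ ∑ i, x i * x i = (3 : ℝ)}.ncard ≤ 960 ∧
      ∃ s ∈ shadow (L : Set (Fin 36 → ℝ)), ∑ i, s i * s i ≤ (5 : ℝ) := by
  have hL : ∀ v, v ∈ L ↔ ∀ w ∈ L, ∃ m : ℤ, v ⬝ᵥ w = m := fun v ↦ Set.ext_iff.mp huni v
  obtain ⟨s, ν, μ, hs, hν, hμ, hodd', hsν, hsμ, h⟩ := exists_thetaTriple L hL fun x hx hx0 ↦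
    le_trans (by norm_num) (hmin x hx hx0)
  have hν0 : ∀ x : L, ν x < 3 ↔ x = 0 := fun x ↦ by
    constructor
    · intro hx
      by_contra hx0
      have h3 : (3 : ℝ) ≤ x.1 ⬝ᵥ x.1 := hmin x.1 x.2 fun h ↦ hx0 (Subtype.ext h)
      rw [← hν] at h3
      have : 3 ≤ ν x := by exact_mod_cast h3
      omega
    · rintro rfl
      have h0 := hν 0
      rw [ZeroMemClass.coe_zero, zero_dotProduct] at h0
      have : ν 0 = 0 := by exact_mod_cast h0
      omega
  have hν00 : ν 0 = 0 := by
    have h0 := hν 0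
    rw [ZeroMemClass.coe_zero, zero_dotProduct] at h0
    exact_mod_cast h0
  have h0 : {x | ν x = 0}.ncard = 1 := by
    rw [Set.ncard_eq_one]
    refine ⟨0, Set.ext fun x ↦ ⟨fun hx ↦ (hν0 x).mp ?_, ?_⟩⟩
    · have hx' : ν x = 0 := hx
      omega
    · rintro rfl
      exact hν00
  have hν12 : ∀ j, 1 ≤ j → j < 3 → {x | ν x = j}.ncard = 0 := fun j h1 h3 ↦ by
    convert Set.ncard_empty L
    ext x
    simp only [Set.mem_ofPred_eq, Set.mem_empty_iff_false, iff_false]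
    rintro rfl
    rw [(hν0 x).mp h3, hν00] at h1
    omega
  have hμe : ∀ j, Even j → {x | μ x = j}.ncard = 0 := fun j hj ↦ by
    convert Set.ncard_empty L
    ext x
    simp only [Set.mem_ofPred_eq, Set.mem_empty_iff_false, iff_false]
    rintro rfl
    exact Nat.not_even_iff_odd.mpr (hodd' x) hj
  constructor
  · have key := ThetaTriple.ncard_add_ncard_add_eq hsν hsμ h h0 (hν12 1 le_rfl (by norm_num))
      (hν12 2 (by norm_num) (by norm_num)) (hμe 0 (by decide)) (hμe 2 (by decide))
    have hset : {x : Fin 36 → ℝ | x ∈ L ∧ ∑ i, x i * x i = (3 : ℝ)} =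
        (fun x : L ↦ x.1) '' {x | ν x = 3} := by
      ext x
      constructor
      · rintro ⟨hx, hx3⟩
        have hx' := hν ⟨x, hx⟩
        rw [show x ⬝ᵥ x = 3 from hx3] at hx'
        exact ⟨⟨x, hx⟩, by exact_mod_cast hx', rfl⟩
      · rintro ⟨y, hy, rfl⟩
        have hy' : ν y = 3 := hy
        have h3 := hν y
        rw [hy'] at h3
        exact ⟨y.2, by exact_mod_cast h3.symm⟩
    rw [hset, Set.ncard_image_of_injective _ Subtype.val_injective]
    omega
  · obtain ⟨x, hx⟩ := ThetaTriple.exists_lt_seven hsν hsμ h h0 (hν12 1 le_rfl (by norm_num))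
      (hν12 2 (by norm_num) (by norm_num))
    have hx5 : μ x ≤ 5 := by
      obtain ⟨k, hk⟩ := hodd' x
      omega
    refine ⟨x.1 + s, ⟨fun y hy ↦ ?_, fun hxs ↦ ?_⟩, ?_⟩
    · obtain ⟨hyL, m, hm⟩ := hy
      obtain ⟨k, hk⟩ := hs y hyL
      obtain ⟨l, hl⟩ := (hL x.1).mp x.2 y hyL
      refine ⟨l + m + k, ?_⟩
      rw [show y ⬝ᵥ y = ((2 * m : ℤ) : ℝ) from hm] at hk
      change (x.1 + s) ⬝ᵥ y = _
      rw [add_dotProduct, hl, dotProduct_comm s y]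
      push_cast at hk ⊢
      linarith
    · obtain ⟨y, hy, hyodd⟩ := hodd
      obtain ⟨k, hk⟩ := hs y hy
      have hsL : s ∈ L := by simpa using L.sub_mem hxs x.2
      obtain ⟨l, hl⟩ := (hL y).mp hy s hsL
      refine hyodd ⟨l - k, ?_⟩
      change y ⬝ᵥ y = _
      rw [hl] at hk
      push_cast
      linarith
    · have := hμ x
      change (x.1 + s) ⬝ᵥ (x.1 + s) ≤ 5
      rw [← this]
      exact_mod_cast hx5
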